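/- arXiv:1704.00350 — 2 statements merged into one kernel-verified Lean document; each statement's English description precedes it below -/
import Mathlib

section
/- Let $v_1,\dots,v_n$ be real numbers with $\sum_{i=1}^n v_i^2 \le 1$. Then the fraction of sign vectors $(a_1,\dots,a_n) \in \{-1,+1\}^n$ for which $\left|\sum_{i=1}^n a_i v_i\right| \le 1$ is at least $\frac{37}{98}$. -/
noncomputable def EE : List ℝ → (ℝ → ℝ) → ℝ → ℝ
  | [], f, x => f x
  | v :: l, f, x => (EE l f (x + v) + EE l f (x - v)) / 2

noncomputable def ind (x : ℝ) : ℝ := if |x| ≤ 1 then 1 else 0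

noncomputable def sqs (l : List ℝ) : ℝ := (l.map (fun t => t ^ 2)).sum

lemma sqs_nonneg (l : List ℝ) : 0 ≤ sqs l := by
  induction l with
  | nil => simp [sqs]
  | cons v l ih => simp only [sqs, List.map_cons, List.sum_cons] at *; positivity

lemma sqs_cons (v : ℝ) (l : List ℝ) : sqs (v :: l) = v ^ 2 + sqs l := by simp [sqs]

lemma EE_perm {l m : List ℝ} (h : l.Perm m) (f : ℝ → ℝ) : ∀ x, EE l f x = EE m f x := by
  induction h with
  | nil => intro x; rfl
  | cons v _ ih => intro x; simp [EE, ih]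
  | swap a b l =>
    intro x
    simp only [EE]
    rw [show x + b + a = x + a + b by ring, show x + b - a = x - a + b by ring,
      show x - b + a = x + a - b by ring, show x - b - a = x - a - b by ring]
    ring
  | trans _ _ h1 h2 => intro x; rw [h1, h2]

lemma EE_abs (l : List ℝ) (f : ℝ → ℝ) : ∀ x, EE (l.map (fun t => |t|)) f x = EE l f x := by
  induction l with
  | nil => intro x; rfl
  | cons v l ih =>
    intro x
    simp only [List.map_cons, EE, ih]
    rcases abs_choice v with h | h <;> rw [h]
    rw [show x + -v = x - v by ring, show x - -v = x + v by ring]; ring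

lemma EE_shift (l : List ℝ) (f : ℝ → ℝ) (x : ℝ) :
    ∀ z, EE l f (x + z) = EE l (fun y => f (x + y)) z := by
  induction l with
  | nil => intro z; rfl
  | cons v l ih =>
    intro z
    simp only [EE]
    rw [add_assoc, add_sub_assoc, ih, ih]

lemma EE_neg (l : List ℝ) (f : ℝ → ℝ) (hf : ∀ y, f (-y) = f y) :
    ∀ z, EE l f (-z) = EE l f z := by
  induction l with
  | nil => intro z; exact hf z
  | cons v l ih =>
    intro z
    simp only [EE]
    rw [show -z + v = -(z - v) by ring, show -z - v = -(z + v) by ring, ih, ih]; ring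

lemma ind_neg (y : ℝ) : ind (-y) = ind y := by simp [ind]

lemma EE_le (l : List ℝ) (f g h : ℝ → ℝ) (H : ∀ y, g y ≤ f y + h y) :
    ∀ z, EE l g z ≤ EE l f z + EE l h z := by
  induction l with
  | nil => intro z; exact H z
  | cons v l ih =>
    intro z
    simp only [EE]
    linarith [ih (z + v), ih (z - v)]

lemma EE_fourth (l : List ℝ) (c : ℝ) (hc : 0 ≤ c) :
    ∀ z, 1 - c * (z ^ 4 + 6 * z ^ 2 * sqs l + 3 * sqs l ^ 2) ≤ EE l (fun y => 1 - c * y ^ 4) z := by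
  induction l with
  | nil => intro z; simp [EE, sqs]
  | cons v l ih =>
    intro z
    simp only [EE, sqs_cons]
    have h1 := ih (z + v)
    have h2 := ih (z - v)
    have : 0 ≤ c * v ^ 4 := by positivity
    nlinarith

lemma moment (l : List ℝ) (x : ℝ) (hx0 : 0 ≤ x) (hx : x ≤ 1)
    (hs : sqs l ≤ 2 / 7 * (1 + x) ^ 2) : 37 / 98 ≤ EE l ind x := by
  have h4 : 0 < (1 + x) ^ 4 := by positivity
  set c := ((1 + x) ^ 4)⁻¹ with hc
  have hcp : 0 < c := by positivity
  have hc1 : c * (1 + x) ^ 4 = 1 := by rw [hc]; field_simp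
  have key := EE_le l (fun y => ind (x + y)) (fun y => 1 - c * y ^ 4) (fun y => ind (-x + y)) (by
    intro y
    have hy : 0 ≤ c * y ^ 4 := by positivity
    have hbig : 1 + x < |y| → 1 - c * y ^ 4 ≤ 0 := by
      intro h
      have : (1 + x) ^ 4 ≤ |y| ^ 4 := by gcongr
      rw [Even.pow_abs (by decide)] at this
      have := mul_le_mul_of_nonneg_left this hcp.le
      linarith
    by_cases h : 1 + x < |y|
    · have := hbig h
      have h1 : 0 ≤ ind (x + y) := by unfold ind; split_ifs <;> norm_num
      have h2 : 0 ≤ ind (-x + y) := by unfold ind; split_ifs <;> norm_num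
      linarith
    · push Not at h
      rw [abs_le] at h
      simp only [ind, abs_le]
      split_ifs with h1 h2 h2
      · linarith
      · linarith
      · linarith
      · exfalso
        rcases le_total 0 y with hy | hy
        · exact h2 ⟨by linarith, by linarith⟩
        · exact h1 ⟨by linarith, by linarith⟩) 0
  rw [← EE_shift, ← EE_shift, add_zero, add_zero, EE_neg l ind ind_neg] at key
  have h5 := EE_fourth l c hcp.le 0
  have h6 : sqs l ^ 2 ≤ (2 / 7 * (1 + x) ^ 2) ^ 2 := pow_le_pow_left₀ (sqs_nonneg l) hs 2
  have h7 := mul_le_mul_of_nonneg_left h6 hcp.le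
  have h8 : c * (2 / 7 * (1 + x) ^ 2) ^ 2 = 4 / 49 := by
    rw [show c * (2 / 7 * (1 + x) ^ 2) ^ 2 = 4 / 49 * (c * (1 + x) ^ 4) by ring, hc1]; ring
  nlinarith

lemma one_end (a x : ℝ) (ha : 0 ≤ a) (ha1 : a ≤ 1) (hx0 : 0 ≤ x) (hx : x ≤ 1) :
    37 / 98 ≤ EE [a] ind x := by
  simp only [EE, ind, abs_le]
  rw [if_pos (⟨by linarith, by linarith⟩ : -1 ≤ x - a ∧ x - a ≤ 1)]
  split_ifs <;> norm_num

lemma absx (l : List ℝ) (x : ℝ) : EE l ind x = EE l ind |x| := by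
  rcases abs_choice x with h | h <;> rw [h]
  rw [EE_neg l ind ind_neg]

lemma two_end (a b x : ℝ) (hb : 0 ≤ b) (hba : b ≤ a) (ha1 : a ≤ 1) (hab : a + 2 * b ≤ 2)
    (hx0 : 0 ≤ x) (hx : x ≤ 1) :
    37 / 98 ≤ EE [b, a] ind x := by
  by_cases h : x ≤ 1 - b
  · have h1 := one_end a |x + b| (by linarith) ha1 (abs_nonneg _)
      (abs_le.2 ⟨by linarith, by linarith⟩)
    have h2 := one_end a |x - b| (by linarith) ha1 (abs_nonneg _)
      (abs_le.2 ⟨by linarith, by linarith⟩)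
    rw [← absx] at h1 h2
    rw [EE]; linarith
  · simp only [EE, ind, abs_le]
    rw [if_pos (⟨by linarith, by linarith⟩ : -1 ≤ x - b - a ∧ x - b - a ≤ 1),
      if_pos (⟨by linarith, by linarith⟩ : -1 ≤ x + b - a ∧ x + b - a ≤ 1)]
    split_ifs <;> norm_num

lemma main_ind (a b w : ℝ) (hb : 0 ≤ b) (hba : b ≤ a) (ha1 : a ≤ 1) (hab : a + 2 * b ≤ 2)
    (m : List ℝ) : (∀ t ∈ m, 0 ≤ t ∧ t ≤ w) → sqs (m ++ [b, a]) + 2 * w ^ 2 ≤ 1 →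
    ∀ x, 0 ≤ x → x ≤ 1 → 37 / 98 ≤ EE (m ++ [b, a]) ind x := by
  induction m with
  | nil => intro _ _ x h0 h1; exact two_end a b x hb hba ha1 hab h0 h1
  | cons v m ih =>
    intro hm hs x hx0 hx1
    obtain ⟨hv0, hvw⟩ := hm v (by simp)
    by_cases h : x ≤ 1 - v
    · have hs' : sqs (m ++ [b, a]) + 2 * w ^ 2 ≤ 1 := by
        rw [List.cons_append, sqs_cons] at hs; nlinarith
      have hv1 : v ≤ 1 := by linarith
      have ih' := ih (fun t ht => hm t (by simp [ht])) hs'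
      have h1 := ih' |x + v| (abs_nonneg _) (abs_le.2 ⟨by linarith, by linarith⟩)
      have h2 := ih' |x - v| (abs_nonneg _) (abs_le.2 ⟨by linarith, by linarith⟩)
      rw [← absx] at h1 h2
      rw [List.cons_append, EE]; linarith
    · apply moment _ _ hx0 hx1
      push Not at h
      have hv1 : v ≤ 1 := by
        have := sqs_nonneg (v :: m ++ [b, a])
        nlinarith
      have : (2 - v) ^ 2 ≤ (1 + x) ^ 2 := pow_le_pow_left₀ (by linarith) (by linarith) 2
      nlinarith [sq_nonneg (4 * v - 1), mul_self_le_mul_self hv0 hvw]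

lemma four (a c b d : ℝ) (m : List ℝ) (h1 : c ≤ a) (h2 : b ≤ c) (h3 : d ≤ b) (h4 : 0 ≤ d)
    (hm : ∀ t ∈ m, 0 ≤ t ∧ t ≤ d) (hs : sqs (a :: c :: b :: d :: m) ≤ 1) :
    37 / 98 ≤ EE (a :: c :: b :: d :: m) ind 0 := by
  have hp : (a :: c :: b :: d :: m).Perm (c :: d :: (m ++ [b, a])) := by
    rw [← Multiset.coe_eq_coe]
    simp only [← Multiset.cons_coe, ← Multiset.coe_add, ← Multiset.singleton_add,
      ← Multiset.coe_nil]
    abel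
  rw [EE_perm hp]
  have hs2 : sqs (c :: d :: (m ++ [b, a])) ≤ 1 := by
    have : sqs (c :: d :: (m ++ [b, a])) = sqs (a :: c :: b :: d :: m) :=
      ((hp.map _).sum_eq).symm
    linarith
  have hm0 := sqs_nonneg m
  simp only [sqs_cons] at hs hs2
  have ha1 : a ≤ 1 := by nlinarith [sq_nonneg c, sq_nonneg b, sq_nonneg d]
  have hbc : b ^ 2 ≤ c ^ 2 := by gcongr; linarith
  have hdc : d ^ 2 ≤ c ^ 2 := by gcongr; linarith
  have hca : c ^ 2 ≤ a ^ 2 := by gcongr; linarith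
  have hdb : d ^ 2 ≤ b ^ 2 := by gcongr
  have hab : a + 2 * b ≤ 2 := by nlinarith [sq_nonneg (a - b), sq_nonneg (a + 2 * b - 2), sq_nonneg d]
  have hcd : c + d ≤ 1 := by nlinarith [sq_nonneg (c - d)]
  have key := main_ind a b d (by linarith) (by linarith) ha1 hab m hm (by linarith)
  have k1 := key (c + d) (by linarith) hcd
  have k2 := key (c - d) (by linarith) (by linarith)
  have k3 := EE_neg (m ++ [b, a]) ind ind_neg (c + d)
  have k4 := EE_neg (m ++ [b, a]) ind ind_neg (c - d)
  simp only [EE]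
  rw [show (0:ℝ) + c + d = c + d by ring, show (0:ℝ) + c - d = c - d by ring,
    show (0:ℝ) - c + d = -(c - d) by ring, show (0:ℝ) - c - d = -(c + d) by ring, k3, k4]
  linarith

lemma list_main (l : List ℝ) (hs : sqs l ≤ 1) : 37 / 98 ≤ EE l ind 0 := by
  have hz : ∀ l : List ℝ, EE (0 :: l) ind 0 = EE l ind 0 := by intro l; simp [EE]
  have hz2 : ∀ l : List ℝ, sqs (0 :: l) = sqs l := by intro l; simp [sqs]
  rw [← hz, ← hz, ← hz, ← hz, ← EE_abs]
  rw [← hz2, ← hz2, ← hz2, ← hz2] at hs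
  set L : List ℝ := 0 :: 0 :: 0 :: 0 :: l with hL
  set M := L.map (fun t => |t|) with hM
  have hsM : sqs M ≤ 1 := by
    have : sqs M = sqs L := by simp [sqs, hM, Function.comp_def]
    linarith
  have hMp := List.perm_insertionSort (· ≥ ·) M
  have hso := List.pairwise_insertionSort (· ≥ ·) M
  rw [← EE_perm hMp]
  have hsS : sqs (M.insertionSort (· ≥ ·)) ≤ 1 := by
    have : sqs (M.insertionSort (· ≥ ·)) = sqs M := (hMp.map _).sum_eq
    linarith
  have hnn : ∀ t ∈ M.insertionSort (· ≥ ·), 0 ≤ t := by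
    intro t ht
    rw [hMp.mem_iff, hM, List.mem_map] at ht
    obtain ⟨s, _, rfl⟩ := ht
    exact abs_nonneg s
  have hlen : 4 ≤ (M.insertionSort (· ≥ ·)).length := by
    rw [hMp.length_eq, hM, hL]; simp
  generalize M.insertionSort (· ≥ ·) = S at *
  match S, hlen with
  | a :: c :: b :: d :: m, _ =>
    simp only [List.pairwise_cons] at hso
    obtain ⟨p1, p2, p3, p4, _⟩ := hso
    exact four a c b d m (p1 c (by simp)) (p2 b (by simp)) (p3 d (by simp)) (hnn d (by simp))
      (fun t ht => ⟨hnn t (by simp [ht]), p4 t ht⟩) hsS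

lemma sum_eq (f : ℝ → ℝ) : ∀ (n : ℕ) (v : Fin n → ℝ) (x : ℝ),
    (∑ a : Fin n → Bool, f (x + ∑ i, (if a i then (1:ℝ) else -1) * v i)) / 2 ^ n
      = EE (List.ofFn v) f x := by
  intro n
  induction n with
  | zero => intro v x; simp [EE]
  | succ n ih =>
    intro v x
    rw [List.ofFn_succ, EE, ← ih, ← ih, ← (Fin.consEquiv (fun _ => Bool)).sum_comp,
      Fintype.sum_prod_type, Fintype.sum_bool]
    simp only [Fin.consEquiv_apply, Fin.sum_univ_succ, Fin.cons_zero, Fin.cons_succ, if_true,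
      Bool.false_eq_true, if_false, one_mul, neg_one_mul, ← add_assoc, ← sub_eq_add_neg]
    rw [pow_succ]
    field_simp

theorem thm_37_98 (n : ℕ) (v : Fin n → ℝ) (hv : ∑ i, v i ^ 2 ≤ 1) :
    (37 : ℝ) / 98 ≤
      (∑ a : Fin n → Bool,
        if |∑ i, (if a i then (1:ℝ) else -1) * v i| ≤ 1 then (1:ℝ) else 0) / 2 ^ n := by
  have h := list_main (List.ofFn v) (by
    simpa [sqs, List.map_ofFn, List.sum_ofFn] using hv)
  rw [← sum_eq] at h
  simpa only [ind, zero_add] using h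
end

section
/- Let $p \ge 2$ be real and $B_p = \frac{2^{p/2}\Gamma(\frac{p+1}{2})}{\sqrt{\pi}}$. Let $v_1,\dots,v_n$ be real numbers, $a_1,\dots,a_n$ independent uniform random signs, and $S = \sum_{i=1}^n a_i v_i$. Then $\mathbb{E}(|S|^p) \le B_p \left(\sum_{i=1}^n v_i^2\right)^{p/2}$. -/
section

lemma kh_gamma_const : Real.eulerMascheroniConstant < 0.58501 := by
  have h := Real.eulerMascheroniConstant_lt_eulerMascheroniSeq' 64
  have h2 : Real.eulerMascheroniSeq' 64 < 0.58501 := by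
    have hl : Real.log 64 = 6 * Real.log 2 := by
      rw [show (64:ℝ) = 2 ^ 6 by norm_num, Real.log_pow]; norm_num
    simp only [Real.eulerMascheroniSeq']
    norm_num [harmonic, Finset.sum_range_succ, hl]
    have := Real.log_two_gt_d9
    norm_num at this ⊢
    linarith
  linarith

lemma kh_log_Gamma_shift {x : ℝ} (hx : 0 < x) :
    Real.log (Real.Gamma (x + 3)) = Real.log (Real.Gamma x) + Real.log x + Real.log (x + 1)
      + Real.log (x + 2) := by
  have h1 := Real.Gamma_add_one (s := x) hx.ne'
  have h2 := Real.Gamma_add_one (s := x + 1) (by positivity)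
  have h3 := Real.Gamma_add_one (s := x + 2) (by positivity)
  have e2 : x + 1 + 1 = x + 2 := by ring
  have e3 : x + 2 + 1 = x + 3 := by ring
  rw [e2] at h2
  rw [e3] at h3
  have hG := (Real.Gamma_pos_of_pos hx).ne'
  rw [h3, h2, h1, Real.log_mul (by positivity) (by positivity),
    Real.log_mul (by positivity) (by positivity), Real.log_mul (by positivity) (by positivity)]
  ring

lemma kh_log_Gamma_deriv :
    HasDerivAt (Real.log ∘ Real.Gamma)
      (-(Real.eulerMascheroniConstant + 2 * Real.log 2) + 2 + 2 / 3 + 2 / 5) (7 / 2) := by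
  have h0 := Real.hasDerivAt_Gamma_one_half
  have h1 : HasDerivAt (fun x => Real.log (Real.Gamma x))
      (-(Real.eulerMascheroniConstant + 2 * Real.log 2)) (1/2) := by
    have := h0.log (by rw [Real.Gamma_one_half_eq]; positivity)
    rw [Real.Gamma_one_half_eq] at this
    convert this using 1
    have : √Real.pi ≠ 0 := by positivity
    field_simp
  have h2 : HasDerivAt (fun x : ℝ => Real.log (Real.Gamma x) + Real.log x + Real.log (x + 1)
      + Real.log (x + 2))
      (-(Real.eulerMascheroniConstant + 2 * Real.log 2) + 2 + 2 / 3 + 2 / 5) (1/2) := by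
    have a := Real.hasDerivAt_log (x := 1/2) (by norm_num)
    have b := ((hasDerivAt_id (1/2 : ℝ)).add_const 1).log (by norm_num)
    have c := ((hasDerivAt_id (1/2 : ℝ)).add_const 2).log (by norm_num)
    exact (((h1.add a).add b).add c).congr_deriv (by norm_num)
  have h3 : HasDerivAt (fun x : ℝ => Real.log (Real.Gamma (x + 3)))
      (-(Real.eulerMascheroniConstant + 2 * Real.log 2) + 2 + 2 / 3 + 2 / 5) (1/2) := by
    refine h2.congr_of_eventuallyEq ?_
    filter_upwards [lt_mem_nhds (show (0:ℝ) < 1/2 by norm_num)] with x hx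
    exact kh_log_Gamma_shift hx
  have h4 : HasDerivAt (fun x : ℝ => x - 3) 1 (7/2) := (hasDerivAt_id _).sub_const 3
  have h5 : HasDerivAt (fun x : ℝ => Real.log (Real.Gamma (x + 3)))
      (-(Real.eulerMascheroniConstant + 2 * Real.log 2) + 2 + 2 / 3 + 2 / 5) ((7/2 : ℝ) - 3) := by
    convert h3 using 1; norm_num
  have h6 := h5.comp (7/2) h4
  rw [mul_one] at h6
  have h7 : (Real.log ∘ Real.Gamma) =
      (fun x : ℝ => Real.log (Real.Gamma (x + 3))) ∘ (fun x : ℝ => x - 3) := by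
    funext x; simp
  rw [h7]
  exact h6

/-- lower bound for the Gaussian moment ratio -/
lemma kh_g_lower {q : ℝ} (h0 : 0 < q) (h1 : q ≤ 1) :
    1 + 0.014 * q + 0.06 * q ^ 2 ≤ Real.Gamma ((q + 3) / 2) / (√Real.pi / 2) := by
  set Ψ := -(Real.eulerMascheroniConstant + 2 * Real.log 2) + 2 + 2 / 3 + 2 / 5 with hΨ
  have hΨl : 1.09536 ≤ Ψ := by
    have := kh_gamma_const
    have := Real.log_two_lt_d9
    rw [hΨ]; norm_num at *; linarith
  have ht := Real.convexOn_log_Gamma.le_slope_of_hasDerivAt (x := 7/2) (y := 7/2 + q/2)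
    (by simp) (by simp; positivity) (by linarith) kh_log_Gamma_deriv
  rw [slope_def_field, le_div_iff₀ (by linarith)] at ht
  simp only [Function.comp] at ht
  have e1 := kh_log_Gamma_shift (x := (1/2 : ℝ)) (by norm_num)
  have G1 : Real.Gamma (7/2) = 15/4 * (√Real.pi / 2) := by
    have a := Real.Gamma_add_one (s := 1/2) (by norm_num)
    have b := Real.Gamma_add_one (s := 3/2) (by norm_num)
    have c := Real.Gamma_add_one (s := 5/2) (by norm_num)
    norm_num at a b c
    rw [c, b, a]
    rw [Real.Gamma_one_half_eq]
    ring
  have G2 : Real.Gamma (7/2 + q/2) = (5/2 + q/2) * ((3/2+q/2) * Real.Gamma ((q+3)/2)) := by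
    have b := Real.Gamma_add_one (s := 3/2 + q/2) (by positivity)
    have c := Real.Gamma_add_one (s := 5/2 + q/2) (by positivity)
    rw [show 7/2 + q/2 = 5/2 + q/2 + 1 by ring, c, show 5/2 + q/2 = 3/2 + q/2 + 1 by ring, b]
    rw [show (q+3)/2 = 3/2 + q/2 by ring]
  set G := Real.Gamma ((q+3)/2) with hG
  have hGp : 0 < G := Real.Gamma_pos_of_pos (by positivity)
  have hsp : 0 < √Real.pi := by positivity
  have hz : 0.54768 * q ≤ Real.log (Real.Gamma (7/2 + q/2)) - Real.log (Real.Gamma (7/2)) := by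
    nlinarith
  rw [← Real.log_div (by rw [G2]; positivity) (by rw [G1]; positivity)] at hz
  rw [Real.le_log_iff_exp_le (by rw [G2, G1]; positivity), G2, G1] at hz
  have hexp : 1 + 0.54768 * q + (0.54768*q)^2/2 + (0.54768*q)^3/6 ≤ Real.exp (0.54768 * q) := by
    have := Real.sum_le_exp_of_nonneg (x := 0.54768 * q) (by positivity) 4
    simp [Finset.sum_range_succ, Nat.factorial] at this
    norm_num at this ⊢
    linarith
  have h3 := hexp.trans hz
  rw [show (5 / 2 + q / 2) * ((3 / 2 + q / 2) * G) / (15 / 4 * (√Real.pi / 2))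
    = (G / (√Real.pi/2)) * ((1+q/5)*(1+q/3)) by field_simp; ring] at h3
  have hpos : 0 < (1+q/5)*(1+q/3) := by positivity
  refine le_of_mul_le_mul_right (le_trans ?_ h3) hpos
  nlinarith [mul_pos h0 h0, mul_pos (mul_pos h0 h0) h0, mul_nonneg (mul_pos h0 h0).le (sub_nonneg.2 h1), mul_nonneg (mul_pos (mul_pos h0 h0) h0).le (sub_nonneg.2 h1)]

end

section
open MeasureTheory ProbabilityTheory Set

/-- the Gaussian moment constant -/
noncomputable def kh_B (p : ℝ) : ℝ := 2 ^ (p / 2) * Real.Gamma ((p + 1) / 2) / Real.sqrt Real.pi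

lemma kh_gauss_abs_int (p : ℝ) (hp : 0 < p) (v : NNReal) (z : ℝ) :
    Integrable (fun x : ℝ => |z + x| ^ p) (gaussianReal 0 v) := by
  have h : MemLp (fun x : ℝ => z + x) (ENNReal.ofReal p) (gaussianReal 0 v) := by
    refine MemLp.add (memLp_const z) ?_
    exact memLp_id_gaussianReal' _ ENNReal.ofReal_ne_top
  have := h.integrable_norm_rpow (by simpa using hp) ENNReal.ofReal_ne_top
  rw [ENNReal.toReal_ofReal hp.le] at this
  exact this

lemma kh_gauss_moment (p : ℝ) (hp : 0 < p) :
    ∫ x : ℝ, |x| ^ p ∂(gaussianReal 0 1) = kh_B p := by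
  rw [integral_gaussianReal_eq_integral_smul one_ne_zero]
  have e : (fun x : ℝ => gaussianPDFReal 0 1 x • |x| ^ p) =
      fun x : ℝ => (fun y : ℝ => (√(2 * Real.pi))⁻¹ * (y ^ p * Real.exp (-(1/2) * y ^ (2:ℝ)))) |x| := by
    funext x
    simp [gaussianPDFReal]
    ring_nf
  rw [e, integral_comp_abs (f := fun y : ℝ => (√(2 * Real.pi))⁻¹ * (y ^ p * Real.exp (-(1/2) * y ^ (2:ℝ)))), integral_const_mul,
    integral_rpow_mul_exp_neg_mul_rpow (by norm_num) (by linarith) (by norm_num), kh_B]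
  rw [show -(p+1)/2 = -(p/2) - 1/2 by ring, Real.rpow_sub (by norm_num), one_div, 
    Real.inv_rpow (by norm_num), Real.rpow_neg (by norm_num), inv_inv, ← one_div (2:ℝ), ← Real.sqrt_eq_rpow,
    one_div, Real.sqrt_inv, Real.sqrt_mul (by norm_num)]
  have : √2 ≠ 0 := by positivity
  have : √Real.pi ≠ 0 := by positivity
  field_simp

lemma kh_gauss_sq (v : NNReal) : ∫ x : ℝ, x ^ 2 ∂(gaussianReal 0 v) = v := by
  have h := variance_id_gaussianReal (μ := 0) (v := v)
  rw [variance_eq_sub (memLp_id_gaussianReal' 2 (by simp))] at h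
  simp only [id, integral_id_gaussianReal] at h
  simpa using h

lemma kh_gauss_cos (t : ℝ) :
    ∫ x : ℝ, Real.cos (t * x) ∂(gaussianReal 0 1) = Real.exp (-t ^ 2 / 2) := by
  have h := charFun_gaussianReal (μ := 0) (v := 1) t
  rw [charFun_apply_real] at h
  have hi : Integrable (fun x : ℝ => Complex.exp (↑t * ↑x * Complex.I)) (gaussianReal 0 1) := by
    refine Integrable.of_bound (C := 1) (by fun_prop) ?_
    filter_upwards with x
    rw [show (t:ℂ) * x * Complex.I = ((t * x : ℝ) : ℂ) * Complex.I by push_cast; ring]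
    rw [Complex.norm_exp_ofReal_mul_I]
  have h2 := congrArg Complex.re h
  have h3 : (∫ x : ℝ, Complex.exp (↑t * ↑x * Complex.I) ∂(gaussianReal 0 1)).re =
      ∫ x : ℝ, (Complex.exp (↑t * ↑x * Complex.I)).re ∂(gaussianReal 0 1) := 
    (integral_re hi).symm
  rw [h3] at h2
  have e : (fun x : ℝ => (Complex.exp (↑t * ↑x * Complex.I)).re) = fun x => Real.cos (t * x) := by
    funext x
    rw [show (t:ℂ) * x * Complex.I = ((t * x : ℝ) : ℂ) * Complex.I by push_cast; ring,
      Complex.exp_ofReal_mul_I_re]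
  rw [e] at h2
  rw [h2]
  rw [show (↑t * ((0:ℝ):ℂ) * Complex.I - ↑((1:NNReal):ℝ) * ↑t ^ 2 / 2 : ℂ) = ((-t^2/2 : ℝ) : ℂ) by push_cast; ring,
    Complex.exp_ofReal_re]

noncomputable def kh_W (u : ℝ) : ℝ := Real.cos u - 1 + u ^ 2 / 2

lemma kh_W_nonneg (u : ℝ) : 0 ≤ kh_W u := by
  have := Real.one_sub_sq_div_two_le_cos (x := u)
  unfold kh_W; linarith

lemma kh_W_cont : Continuous kh_W := by unfold kh_W; fun_prop

lemma kh_W_abs (u : ℝ) : kh_W |u| = kh_W u := by unfold kh_W; simp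

noncomputable def kh_K (p : ℝ) : ℝ := ∫ t in Ioi (0:ℝ), kh_W t * t ^ (-p - 1)

lemma kh_K_int {p : ℝ} (h2 : 2 < p) (h4 : p < 4) :
    IntegrableOn (fun t => kh_W t * t ^ (-p - 1)) (Ioi (0:ℝ)) := by
  have hm : ∀ s : Set ℝ, AEStronglyMeasurable (fun t => kh_W t * t ^ (-p - 1)) (volume.restrict s) := by
    intro s
    have := kh_W_cont.measurable
    exact Measurable.aestronglyMeasurable (by fun_prop)
  rw [← Ioc_union_Ioi_eq_Ioi (zero_le_one (α := ℝ))]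
  refine IntegrableOn.union ?_ ?_
  · have h : IntegrableOn (fun t : ℝ => (5/96) * t ^ (3 - p)) (Ioc 0 1) := by
      have := (intervalIntegral.intervalIntegrable_rpow' (r := 3 - p) (by linarith) (a := 0) (b := 1))
      rw [intervalIntegrable_iff_integrableOn_Ioc_of_le zero_le_one] at this
      exact this.const_mul _
    refine Integrable.mono' h (hm _) ?_
    refine (ae_restrict_iff' measurableSet_Ioc).2 (Filter.Eventually.of_forall fun t ht => ?_)
    have ht0 : 0 < t := ht.1
    have hb := Real.cos_bound (x := t) (by rw [abs_of_pos ht0]; exact ht.2)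
    rw [abs_of_pos ht0] at hb
    have hW := kh_W_nonneg t
    rw [Real.norm_of_nonneg (mul_nonneg hW (by positivity))]
    have : kh_W t ≤ t ^ 4 * (5/96) := by
      have := (abs_le.1 hb).2
      unfold kh_W; linarith
    calc kh_W t * t ^ (-p - 1) ≤ (t ^ 4 * (5/96)) * t ^ (-p-1) := by gcongr
      _ = 5/96 * (t ^ (4:ℝ) * t ^ (-p-1)) := by norm_num; ring
      _ = _ := by rw [← Real.rpow_add ht0]; ring_nf
  · have h : IntegrableOn (fun t : ℝ => (1/2) * t ^ (1 - p)) (Ioi 1) := 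
      (integrableOn_Ioi_rpow_of_lt (by linarith) one_pos).const_mul _
    refine Integrable.mono' h (hm _) ?_
    refine (ae_restrict_iff' measurableSet_Ioi).2 (Filter.Eventually.of_forall fun t ht => ?_)
    have ht0 : 0 < t := lt_trans one_pos ht
    have hW := kh_W_nonneg t
    rw [Real.norm_of_nonneg (mul_nonneg hW (by positivity))]
    have : kh_W t ≤ t ^ 2 / 2 := by
      have := Real.cos_le_one t
      unfold kh_W; linarith
    calc kh_W t * t ^ (-p - 1) ≤ (t ^ 2 / 2) * t ^ (-p-1) := by gcongr
      _ = 1/2 * (t ^ (2:ℝ) * t ^ (-p-1)) := by norm_num; ring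
      _ = _ := by rw [← Real.rpow_add ht0]; ring_nf

lemma kh_K_pos {p : ℝ} (h2 : 2 < p) (h4 : p < 4) : 0 < kh_K p := by
  unfold kh_K
  rw [setIntegral_pos_iff_support_of_nonneg_ae ?_ (kh_K_int h2 h4)]
  · have : Ioo (3:ℝ) 4 ⊆ Function.support (fun t => kh_W t * t ^ (-p - 1)) ∩ Ioi 0 := by
      intro t ht
      have ht0 : 0 < t := by linarith [ht.1]
      refine ⟨?_, ht0⟩
      have := Real.neg_one_le_cos t
      have : 0 < kh_W t := by unfold kh_W; nlinarith [ht.1]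
      simp only [Function.mem_support]
      positivity
    refine lt_of_lt_of_le ?_ (measure_mono this)
    simp
    norm_num
  · refine (ae_restrict_iff' measurableSet_Ioi).2 (Filter.Eventually.of_forall fun t ht => ?_)
    have ht0 : 0 < t := ht
    exact mul_nonneg (kh_W_nonneg t) (by positivity)

lemma kh_scale_aux {p x : ℝ} (hx : 0 < x) (t : ℝ) (ht : t ∈ Ioi (0:ℝ)) :
    kh_W (x * t) * t ^ (-p - 1) = x ^ (p + 1) * (kh_W (x * t) * (x * t) ^ (-p - 1)) := by
  have ht0 : 0 < t := ht
  rw [Real.mul_rpow hx.le ht0.le, show -p - 1 = -(p+1) by ring, Real.rpow_neg hx.le]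
  have : x ^ (p+1) ≠ 0 := by positivity
  field_simp

lemma kh_scale_int {p : ℝ} (h2 : 2 < p) (h4 : p < 4) (x : ℝ) :
    IntegrableOn (fun t => kh_W (x * t) * t ^ (-p - 1)) (Ioi (0:ℝ)) := by
  wlog hx : 0 < x generalizing x
  · rcases eq_or_lt_of_le (not_lt.1 hx) with h | h
    · subst h; simp [kh_W]
    · have := this (-x) (by linarith)
      refine this.congr_fun (fun t _ => ?_) measurableSet_Ioi
      simp [kh_W]
  refine IntegrableOn.congr_fun ?_ (fun t ht => (kh_scale_aux (p := p) hx t ht).symm) measurableSet_Ioi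
  refine Integrable.const_mul ?_ _
  have := (integrableOn_Ioi_comp_mul_left_iff (fun t => kh_W t * t ^ (-p - 1)) 0 hx).2
    (by simpa using kh_K_int h2 h4)
  exact this

lemma kh_scale {p : ℝ} (h2 : 2 < p) (x : ℝ) :
    ∫ t in Ioi (0:ℝ), kh_W (x * t) * t ^ (-p - 1) = |x| ^ p * kh_K p := by
  wlog hx : 0 < x generalizing x
  · rcases eq_or_lt_of_le (not_lt.1 hx) with h | h
    · subst h; simp [kh_W]; left; rw [Real.zero_rpow (by linarith)]
    · have := this (-x) (by linarith)
      rw [abs_neg] at this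
      rw [← this]
      simp [kh_W]
  rw [setIntegral_congr_fun measurableSet_Ioi (fun t ht => kh_scale_aux (p := p) hx t ht),
    integral_const_mul, integral_comp_mul_left_Ioi (fun t => kh_W t * t ^ (-p - 1)) 0 hx]
  rw [mul_zero, abs_of_pos hx, Real.rpow_add hx, Real.rpow_one, kh_K, smul_eq_mul]
  field_simp

/-- The Gaussian version -/
lemma kh_gauss_rep {p : ℝ} (h2 : 2 < p) (h4 : p < 4) {s : ℝ} (hs : 0 < s) :
    IntegrableOn (fun t => (Real.exp (-s * t ^ 2 / 2) - 1 + s * t ^ 2 / 2) * t ^ (-p - 1)) (Ioi (0:ℝ)) ∧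
    ∫ t in Ioi (0:ℝ), (Real.exp (-s * t ^ 2 / 2) - 1 + s * t ^ 2 / 2) * t ^ (-p - 1)
      = s ^ (p / 2) * kh_B p * kh_K p := by
  have hsq : 0 < √s := Real.sqrt_pos.2 hs
  have hss : √s ^ 2 = s := Real.sq_sqrt hs.le
  have hI : Integrable (Function.uncurry fun (x t : ℝ) => kh_W (√s * x * t) * t ^ (-p - 1))
      ((gaussianReal 0 1).prod (volume.restrict (Ioi 0))) := by
    rw [integrable_prod_iff]
    · constructor
      · refine Filter.Eventually.of_forall fun x => ?_
        have := kh_scale_int h2 h4 (√s * x)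
        simp only [Function.uncurry_apply_pair]
        exact this
      have e : (fun x : ℝ => ∫ t in Ioi (0:ℝ), ‖Function.uncurry (fun (x t : ℝ) => kh_W (√s * x * t) * t ^ (-p - 1)) (x, t)‖)
          = fun x => |0 + x| ^ p * (√s ^ p * kh_K p) := by
        funext x
        have : ∫ t in Ioi (0:ℝ), ‖Function.uncurry (fun (x t : ℝ) => kh_W (√s * x * t) * t ^ (-p - 1)) (x, t)‖
          = ∫ t in Ioi (0:ℝ), kh_W (√s * x * t) * t ^ (-p - 1) := by
          refine setIntegral_congr_fun measurableSet_Ioi fun t ht => ?_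
          have ht0 : 0 < t := ht
          exact Real.norm_of_nonneg (mul_nonneg (kh_W_nonneg _) (by positivity))
        rw [this, kh_scale h2, abs_mul, abs_of_pos hsq, Real.mul_rpow hsq.le (abs_nonneg _), zero_add]
        ring
      rw [e]
      exact (kh_gauss_abs_int p (by linarith) 1 0).mul_const _
    · have := kh_W_cont.measurable
      refine Measurable.aestronglyMeasurable ?_
      simp only [Function.uncurry_def]
      fun_prop
  have hinner : ∀ t ∈ Ioi (0:ℝ), (∫ x, kh_W (√s * x * t) * t ^ (-p - 1) ∂(gaussianReal 0 1)) =
      (Real.exp (-s * t ^ 2 / 2) - 1 + s * t ^ 2 / 2) * t ^ (-p - 1) := by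
    intro t _
    rw [integral_mul_const]
    congr 1
    have e : (fun x => kh_W (√s * x * t)) = fun x => (Real.cos ((√s * t) * x) - 1) + (s * t ^ 2 / 2) * x ^ 2 := by
      funext x
      unfold kh_W
      rw [show √s * x * t = √s * t * x by ring, mul_pow, mul_pow, hss]
      ring
    have hc : Integrable (fun x => Real.cos ((√s * t) * x)) (gaussianReal 0 1) := by
      refine Integrable.of_bound (C := 1) (by fun_prop) ?_
      filter_upwards with x
      exact Real.abs_cos_le_one _
    have hq : Integrable (fun x : ℝ => x ^ 2) (gaussianReal 0 1) := by
      have := kh_gauss_abs_int 2 (by norm_num) 1 0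
      simpa using this
    have hc1 : Integrable (fun x => Real.cos ((√s * t) * x) - 1) (gaussianReal 0 1) :=
      hc.sub (integrable_const _)
    rw [e, integral_add hc1 (hq.const_mul _), integral_sub hc (integrable_const _),
      kh_gauss_cos, integral_const_mul, kh_gauss_sq, mul_pow, hss]
    simp
  constructor
  · have := hI.integral_prod_right
    simp only [Function.uncurry] at this
    exact IntegrableOn.congr_fun this hinner measurableSet_Ioi
  · rw [← setIntegral_congr_fun measurableSet_Ioi hinner, ← integral_integral_swap hI]
    simp only [kh_scale h2]
    rw [integral_mul_const]
    congr 1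
    have e : (fun x : ℝ => |√s * x| ^ p) = fun x => √s ^ p * |x| ^ p := by
      funext x
      rw [abs_mul, abs_of_pos hsq, Real.mul_rpow hsq.le (abs_nonneg _)]
    rw [e, integral_const_mul, kh_gauss_moment p (by linarith), Real.sqrt_eq_rpow, ← Real.rpow_mul hs.le]
    ring_nf

end

section

lemma kh_exp3 {x : ℝ} (hx : 0 ≤ x) : 1 + x + x^2/2 + x^3/6 ≤ Real.exp x := by
  have := Real.sum_le_exp_of_nonneg hx 4
  simp [Finset.sum_range_succ, Nat.factorial] at this
  norm_num at this ⊢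
  linarith

lemma kh_two_le {q : ℝ} (h0 : 0 ≤ q) (h1 : q ≤ 1) :
    (2:ℝ) ^ q ≤ 1 + 0.6932 * q + 0.3069 * q ^ 2 := by
  rw [Real.rpow_def_of_pos (by norm_num)]
  have hl := Real.log_two_lt_d9
  have h : Real.exp (Real.log 2 * q) ≤ Real.exp (0.69315 * q) := by
    apply Real.exp_le_exp.2
    apply mul_le_mul_of_nonneg_right _ h0
    norm_num at *; linarith
  refine h.trans ((Real.exp_bound' (n := 6) (by positivity) (by linarith) (by norm_num)).trans ?_)
  simp [Finset.sum_range_succ, Nat.factorial]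
  norm_num
  have a2 : 0 ≤ q^2 := by positivity
  have a3 : q^3 ≤ q^2 := pow_le_pow_of_le_one h0 h1 (by norm_num)
  have a4 : q^4 ≤ q^2 := pow_le_pow_of_le_one h0 h1 (by norm_num)
  have a5 : q^5 ≤ q^2 := pow_le_pow_of_le_one h0 h1 (by norm_num)
  have a6 : q^6 ≤ q^2 := pow_le_pow_of_le_one h0 h1 (by norm_num)
  simp only [mul_pow]
  norm_num
  nlinarith

lemma kh_two_ge {q : ℝ} (h0 : 0 ≤ q) : 1 + 0.693 * q ≤ (2:ℝ) ^ q := by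
  rw [Real.rpow_def_of_pos (by norm_num)]
  have hl := Real.log_two_gt_d9
  have := Real.add_one_le_exp (Real.log 2 * q)
  norm_num at *
  nlinarith

lemma kh_three_ge {q : ℝ} (h0 : 0 ≤ q) : 1 + 1.0986 * q + 0.6034 * q ^ 2 ≤ (3:ℝ) ^ q := by
  rw [Real.rpow_def_of_pos (by norm_num)]
  have hl := Real.log_three_gt_d9
  have h : Real.exp (1.0986 * q) ≤ Real.exp (Real.log 3 * q) := by
    apply Real.exp_le_exp.2
    apply mul_le_mul_of_nonneg_right _ h0
    norm_num at *; linarith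
  refine le_trans ?_ h
  have := kh_exp3 (x := 1.0986 * q) (by positivity)
  have : 0 ≤ (1.0986 * q)^3/6 := by positivity
  nlinarith [sq_nonneg q]

lemma kh_log37 : 1.3082 ≤ Real.log 3.7 := by
  rw [Real.le_log_iff_exp_le (by norm_num)]
  have h1 := Real.exp_one_lt_d9
  have h2 := Real.exp_bound' (x := 0.3082) (n := 5) (by norm_num) (by norm_num) (by norm_num)
  simp [Finset.sum_range_succ, Nat.factorial] at h2
  have : Real.exp 1.3082 = Real.exp 1 * Real.exp 0.3082 := by rw [← Real.exp_add]; norm_num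
  rw [this]
  have h3 : Real.exp 0.3082 ≤ 1.36103 := by norm_num at h2 ⊢; linarith
  calc Real.exp 1 * Real.exp 0.3082 ≤ 2.7182818286 * 1.36103 := by gcongr
    _ ≤ _ := by norm_num

lemma kh_37_ge {q : ℝ} (h0 : 0 ≤ q) : 1 + 0.6541 * q + 0.2139 * q ^ 2 ≤ (3.7:ℝ) ^ (q/2) := by
  rw [Real.rpow_def_of_pos (by norm_num)]
  have hl := kh_log37
  have h : Real.exp (0.6541 * q) ≤ Real.exp (Real.log 3.7 * (q/2)) := by
    apply Real.exp_le_exp.2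
    nlinarith
  refine le_trans ?_ h
  have := kh_exp3 (x := 0.6541 * q) (by positivity)
  have : 0 ≤ (0.6541 * q)^3/6 := by positivity
  nlinarith [sq_nonneg q]

lemma kh_log10 : Real.log 10 ≤ 2.3026 := by
  have h3 : (10:ℝ) = 2 ^ 3 * (5/4) := by norm_num
  rw [h3, Real.log_mul (by norm_num) (by norm_num), Real.log_pow]
  have h := Real.log_two_lt_d9
  have : Real.log (5/4) ≤ 0.22315 := by
    rw [Real.log_le_iff_le_exp (by norm_num)]
    have := Real.sum_le_exp_of_nonneg (x := 0.22315) (by norm_num) 5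
    simp [Finset.sum_range_succ, Nat.factorial] at this
    norm_num at this ⊢
    linarith
  norm_num at *
  linarith

/-- second order bound for powers -/
lemma kh_rpow_le {t τ : ℝ} (ht0 : 0 ≤ t) (ht1 : t ≤ 1) (h0 : 0 ≤ τ) (h1 : τ ≤ 1) :
    t ^ τ ≤ 1 - τ * (1 - t) - 1/2 * τ * (1 - τ) * (1 - t)^2 := by
  rcases eq_or_lt_of_le h0 with h | hτ
  · subst h; simp
  have hA : AntitoneOn (fun t : ℝ => 1 - τ * (1 - t) - 1/2 * τ * (1 - τ) * (1 - t)^2 - t ^ τ)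
      (Set.Icc 0 1) := by
    have hd : ∀ x ∈ Set.Ioo (0:ℝ) 1, HasDerivAt
        (fun t : ℝ => 1 - τ * (1 - t) - 1/2 * τ * (1 - τ) * (1 - t)^2 - t ^ τ)
        (τ + τ * (1 - τ) * (1 - x) - τ * x ^ (τ - 1)) x := by
      intro x hx
      have a := ((hasDerivAt_id x).const_sub 1)
      have b := ((a.const_mul τ).const_sub 1).sub ((a.pow 2).const_mul (1/2 * τ * (1 - τ)))
      have c := Real.hasDerivAt_rpow_const (x := x) (p := τ) (Or.inl hx.1.ne')
      refine (b.sub c).congr_deriv ?_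
      simp
      ring
    apply antitoneOn_of_deriv_nonpos (convex_Icc 0 1)
    · have : Continuous (fun t : ℝ => t ^ τ) := Real.continuous_rpow_const h0
      fun_prop
    · rw [interior_Icc]
      exact fun x hx => (hd x hx).differentiableAt.differentiableWithinAt
    · rw [interior_Icc]
      intro x hx
      rw [(hd x hx).deriv]
      have hxe : 1 + (1 - τ) * (1 - x) ≤ x ^ (τ - 1) := by
        rw [Real.rpow_def_of_pos hx.1]
        have a := Real.add_one_le_exp (Real.log x * (τ - 1))
        have b := Real.log_le_sub_one_of_pos hx.1
        nlinarith
      nlinarith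
  have := hA (Set.mem_Icc.2 ⟨ht0, ht1⟩) (Set.right_mem_Icc.2 zero_le_one) ht1
  simp at this
  linarith

noncomputable def kh_g (q : ℝ) : ℝ := Real.Gamma ((q + 3) / 2) / (√Real.pi / 2)

lemma kh_g_pos {q : ℝ} (h0 : 0 < q) : 0 < kh_g q := by
  have : 0 < Real.Gamma ((q + 3) / 2) := Real.Gamma_pos_of_pos (by positivity)
  unfold kh_g; positivity

lemma kh_g_low {q : ℝ} (h0 : 0 < q) (h1 : q ≤ 1) :
    1 + 0.014 * q + 0.06 * q ^ 2 ≤ kh_g q := kh_g_lower h0 h1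

lemma kh_B_eq (q : ℝ) : kh_B (q + 2) = 2 ^ (q / 2) * kh_g q := by
  unfold kh_B kh_g
  rw [show (q+2)/2 = q/2 + 1 by ring, Real.rpow_add (by norm_num), Real.rpow_one,
    show (q + 2 + 1) = q + 3 by ring]
  have : √Real.pi ≠ 0 := by positivity
  field_simp

lemma kh_I {q δ : ℝ} (h0 : 0 < q) (h1 : q ≤ 1) (hd0 : 0 ≤ δ) (hd1 : δ ≤ 0.075) :
    1 - 1/2 * δ * (2 ^ q - 1) ≤ (1 - δ) ^ (q/2) * kh_g q := by
  have hg := kh_g_low h0 h1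
  have h2 := kh_two_ge h0.le
  have hl : -δ - δ^2/2 - 0.0811 * δ^2 ≤ Real.log (1 - δ) := by
    have := Real.abs_log_sub_add_sum_range_le (x := δ) (by rw [abs_of_nonneg hd0]; norm_num at *; linarith) 2
    rw [abs_of_nonneg hd0] at this
    simp [Finset.sum_range_succ] at this
    norm_num at this
    have h3 := (abs_le.1 this).1
    have h4 : δ^3/(1-δ) ≤ 0.0811 * δ^2 := by
      rw [div_le_iff₀ (by norm_num at *; linarith)]
      have : 0 ≤ δ^2 := sq_nonneg δ
      norm_num at *
      nlinarith
    linarith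
  have he : 1 + (q/2) * (-δ - δ^2/2 - 0.0811 * δ^2) ≤ (1 - δ) ^ (q/2) := by
    rw [Real.rpow_def_of_pos (by norm_num at *; linarith)]
    have := Real.add_one_le_exp (Real.log (1 - δ) * (q/2))
    nlinarith
  set L := δ + δ^2/2 + 0.0811 * δ^2 with hL
  have hL0 : 0 ≤ L := by positivity
  have hL1 : L ≤ δ + 0.5811 * 0.075 * δ := by rw [hL]; norm_num at *; nlinarith
  have e1 : 1 - q/2 * L ≤ (1-δ)^(q/2) := by rw [hL]; linarith
  have e2 : 0 ≤ 1 - q/2*L := by norm_num at *; nlinarith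
  have e3 : (1 - q/2*L) * (1 + 0.014 * q + 0.06 * q ^ 2) ≤ (1 - δ) ^ (q/2) * kh_g q := 
    mul_le_mul e1 hg (by positivity) (by linarith)
  refine le_trans ?_ e3
  have e4 : 1 - 1/2 * δ * (2 ^ q - 1) ≤ 1 - 1/2 * δ * (0.693 * q) := by norm_num at *; nlinarith
  refine e4.trans ?_
  have hL2 : L ≤ 1.0436 * δ := by norm_num at *; linarith
  have k1 : q * L * (0.014 + 0.06 * q) ≤ 0.08 * (0.014 + 0.06 * q) * q := by norm_num at *; nlinarith [mul_pos h0 h0, mul_nonneg h0.le hL0]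
  have k2 : 0 ≤ 0.014 + 0.06*q - L/2 - 1/2 * (0.08 * (0.014 + 0.06 * q)*q) + 1/2*δ*0.693 := by norm_num at *; nlinarith
  have k3 := mul_nonneg h0.le k2
  norm_num at *
  nlinarith [mul_le_mul_of_nonneg_left k1 h0.le]

lemma kh_pade {x : ℝ} (hx : 0 ≤ x) : 3*x*(x+2)/(x^2+6*x+6) ≤ Real.log (1+x) := by
  have hM : MonotoneOn (fun x : ℝ => Real.log (1+x) - 3*x*(x+2)/(x^2+6*x+6)) (Set.Ici 0) := by
    have hd : ∀ x : ℝ, 0 ≤ x → HasDerivAt (fun x : ℝ => Real.log (1+x) - 3*x*(x+2)/(x^2+6*x+6))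
        (x^4/((1+x)*(x^2+6*x+6)^2)) x := by
      intro x hx
      have a := ((hasDerivAt_id x).const_add 1).log (by simp; positivity)
      have b := (((hasDerivAt_id x).const_mul 3).mul ((hasDerivAt_id x).add_const 2)).div
        ((((hasDerivAt_id x).pow 2).add ((hasDerivAt_id x).const_mul 6)).add_const 6) (by simp; positivity)
      refine (a.sub b).congr_deriv ?_
      simp
      have : 1 + x ≠ 0 := by positivity
      have : x^2+6*x+6 ≠ 0 := by positivity
      field_simp
      ring
    apply monotoneOn_of_deriv_nonneg (convex_Ici 0)
    · exact fun x hx => (hd x hx).continuousAt.continuousWithinAt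
    · rw [interior_Ici]
      exact fun x hx => (hd x (le_of_lt hx)).differentiableAt.differentiableWithinAt
    · rw [interior_Ici]
      intro x hx
      have hx0 : 0 < x := hx
      rw [(hd x hx0.le).deriv]
      positivity
  have := hM (Set.mem_Ici.2 le_rfl) (Set.mem_Ici.2 hx) hx
  simp at this
  linarith

lemma kh_logτ {τ : ℝ} (h0 : 0 ≤ τ) (h1 : τ ≤ 1) :
    2 * (0.495 * τ - 0.215 * τ^2 + 0.065 * τ^3) ≤ Real.log (1+τ) := by
  refine le_trans ?_ (kh_pade h0)
  rw [le_div_iff₀ (by positivity)]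
  have h1' : 0 ≤ 1 - τ := by linarith
  have key : 0 ≤ 3*(τ+2) - (0.99 - 0.43 * τ + 0.13*τ^2)*(τ^2+6*τ+6) := by
    have e : 3*(τ+2) - (0.99 - 0.43 * τ + 0.13*τ^2)*(τ^2+6*τ+6) = (3/50)*(τ^0*(1-τ)^10) + (6/25)*(τ^1*(1-τ)^9) + (27/100)*(τ^2*(1-τ)^8) + (37/100)*(τ^3*(1-τ)^7) + (123/50)*(τ^4*(1-τ)^6) + (699/100)*(τ^5*(1-τ)^5) + (487/50)*(τ^6*(1-τ)^4) + (747/100)*(τ^7*(1-τ)^3) + (78/25)*(τ^8*(1-τ)^2) + (61/100)*(τ^9*(1-τ)^1) + (3/100)*(τ^10*(1-τ)^0) := by ring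
    rw [e]; positivity
  nlinarith [mul_nonneg h0 key]

lemma kh_quad {A B C q : ℝ} (E0 : 0 ≤ A - C/4) (E1 : 0 ≤ A + B + 3*C/4) (hC : 0 ≤ C)
    (h0 : 0 ≤ q) (h1 : q ≤ 1) : 0 ≤ A + B*q + C*q^2 := by
  nlinarith [mul_nonneg E0 (sub_nonneg.2 h1), mul_nonneg E1 h0, mul_nonneg hC (sq_nonneg (q - 1/2))]

lemma kh_II {q τ : ℝ} (h0 : 0 < q) (h1 : q ≤ 1) (ht0 : 0 ≤ τ) (ht1 : τ ≤ 1) :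
    1 + τ * 2 ^ q - 1/2 * τ * (1 - τ) * (9/16 * 3 ^ q - 1/2 * 2 ^ q - 1/16) ≤
      (1 + τ) * ((1 + τ) ^ (q/2) * kh_g q) := by
  have hg := kh_g_low h0 h1
  have h2 := kh_two_le h0.le h1
  have h3 := kh_three_ge h0.le
  have ht1' : 0 ≤ 1 - τ := by linarith
  set m := 0.495 * τ - 0.215 * τ^2 + 0.065 * τ^3 with hm
  have hm0 : 0 ≤ m := by
    have : m = τ * (0.28 + 0.215 * (1 - τ) + 0.065 * τ^2) := by rw [hm]; ring
    rw [this]; positivity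
  have he : 1 + q * m + (q*m)^2/2 + (q*m)^3/6 ≤ (1+τ)^(q/2) := by
    rw [Real.rpow_def_of_pos (by positivity)]
    refine (kh_exp3 (by positivity)).trans (Real.exp_le_exp.2 ?_)
    have := kh_logτ ht0 ht1
    nlinarith
  have hp : (1 + q * m + (q*m)^2/2 + (q*m)^3/6) * (1 + 0.014 * q + 0.06 * q ^ 2) ≤ (1+τ)^(q/2) * kh_g q :=
    mul_le_mul he hg (by positivity) (by positivity)
  have hp2 := mul_le_mul_of_nonneg_left hp (show 0 ≤ 1 + τ by positivity)
  refine le_trans ?_ hp2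
  set A := (1+τ)*(m+0.014) - 0.6932*τ + 1/2*τ*(1-τ)*(9/16*1.0986-0.3466) with hA
  set B := (1+τ)*(m^2/2+0.06+0.014*m) - 0.3069*τ + 1/2*τ*(1-τ)*(9/16*0.6034-0.15345) with hB
  set C := (1+τ)*(m^3/6+0.06*m+0.007*m^2) with hC
  have hC0 : 0 ≤ C := by positivity
  have E0 : 0 ≤ A - C/4 := by
    have : A - C/4 = (7/500)*(τ^0*(1-τ)^10) + (13449/160000)*(τ^1*(1-τ)^9) + (42591393/160000000)*(τ^2*(1-τ)^8) + (40363821/64000000)*(τ^3*(1-τ)^7) + (367283051/320000000)*(τ^4*(1-τ)^6) + (238026871/160000000)*(τ^5*(1-τ)^5) + (1258174463/960000000)*(τ^6*(1-τ)^4) + (371856911/480000000)*(τ^7*(1-τ)^3) + (98300243/320000000)*(τ^8*(1-τ)^2) + (25361437/320000000)*(τ^9*(1-τ)^1) + (1697831/160000000)*(τ^10*(1-τ)^0) := by rw [hA, hC, hm]; ring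
    rw [this]; positivity
  have E1 : 0 ≤ A + B + 3*C/4 := by
    have : A + B + 3*C/4 = (37/500)*(τ^0*(1-τ)^10) + (226707/400000)*(τ^1*(1-τ)^9) + (314010221/160000000)*(τ^2*(1-τ)^8) + (259164697/64000000)*(τ^3*(1-τ)^7) + (1752123647/320000000)*(τ^4*(1-τ)^6) + (798290987/160000000)*(τ^5*(1-τ)^5) + (971475137/320000000)*(τ^6*(1-τ)^4) + (192001489/160000000)*(τ^7*(1-τ)^3) + (98908071/320000000)*(τ^8*(1-τ)^2) + (19350489/320000000)*(τ^9*(1-τ)^1) + (1464107/160000000)*(τ^10*(1-τ)^0) := by rw [hA, hB, hC, hm]; ring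
    rw [this]; positivity
  have hABC : 0 ≤ A + B*q + C*q^2 := by
    exact kh_quad E0 E1 hC0 h0.le h1
  have hfin := mul_nonneg h0.le hABC
  have hττ : 0 ≤ 1/2 * τ * (1-τ) := by positivity
  have s1 := mul_le_mul_of_nonneg_left h2 ht0
  have s2 := mul_le_mul_of_nonneg_left h3 hττ
  have s3 := mul_le_mul_of_nonneg_left h2 hττ
  have rest : 0 ≤ (1+τ) * (0.014*q*((q*m)^3/6) + 0.06*q^2*((q*m)^2/2 + (q*m)^3/6)) := by positivity
  have id1 : (1+τ) * ((1 + q * m + (q*m)^2/2 + (q*m)^3/6) * (1 + 0.014 * q + 0.06 * q ^ 2))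
      = 1 + τ * (1 + 0.6932 * q + 0.3069 * q ^ 2) - 1/2*τ*(1-τ)*(9/16*(1 + 1.0986 * q + 0.6034 * q ^ 2)
        - 1/2 * (1 + 0.6932 * q + 0.3069 * q ^ 2) - 1/16) + q * (A + B*q + C*q^2)
        + (1+τ) * (0.014*q*((q*m)^3/6) + 0.06*q^2*((q*m)^2/2 + (q*m)^3/6)) := by
    rw [hA, hB, hC]; ring
  rw [id1]
  linarith

end

section

noncomputable def kh_c1 (q : ℝ) : ℝ := ((3.7:ℝ) ^ (q/2) * kh_g q - 1) / 0.85

lemma kh_c1_ge {q : ℝ} (h0 : 0 < q) (h1 : q ≤ 1) : 0.786 * q + 0.333 * q ^ 2 ≤ kh_c1 q := by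
  unfold kh_c1
  rw [le_div_iff₀ (by norm_num)]
  have a := mul_le_mul (kh_37_ge h0.le) (kh_g_low h0 h1) (by positivity) (by positivity)
  have b3 : 0 ≤ q^3 := by positivity
  have b4 : 0 ≤ q^4 := by positivity
  have b2 : 0 ≤ q^2 := by positivity
  have : (1 + 0.6541 * q + 0.2139 * q ^ 2) * (1 + 0.014 * q + 0.06 * q ^ 2) =
    1 + 0.6681 * q + 0.2830574 * q^2 + (0.6541*0.06+0.2139*0.014)*q^3 + 0.2139*0.06*q^4 := by ring
  rw [this] at a
  norm_num at *
  linarith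

lemma kh_phi_convex {q : ℝ} (h0 : 0 < q) (h1 : q ≤ 1) :
    ConvexOn ℝ (Set.Icc 0 1) (fun y : ℝ => (1+y)^q - (1-y)^q) := by
  have hd : ∀ x ∈ Set.Ioo (0:ℝ) 1, HasDerivAt (fun y : ℝ => (1+y)^q - (1-y)^q)
      (q * ((1+x)^(q-1) + (1-x)^(q-1))) x := by
    intro x hx
    have a := ((hasDerivAt_id x).const_add 1).rpow_const (p := q) (Or.inl (by simp; linarith [hx.1]))
    have b := ((hasDerivAt_id x).const_sub 1).rpow_const (p := q) (Or.inl (by simp; linarith [hx.2]))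
    refine (a.sub b).congr_deriv ?_
    simp; ring
  have hd2 : ∀ x ∈ Set.Ioo (0:ℝ) 1, HasDerivAt (fun y : ℝ => q * ((1+y)^(q-1) + (1-y)^(q-1)))
      (q * ((1-q) * ((1-x)^(q-2) - (1+x)^(q-2)))) x := by
    intro x hx
    have a := ((hasDerivAt_id x).const_add 1).rpow_const (p := q - 1) (Or.inl (by simp; linarith [hx.1]))
    have b := ((hasDerivAt_id x).const_sub 1).rpow_const (p := q - 1) (Or.inl (by simp; linarith [hx.2]))
    refine ((a.add b).const_mul q).congr_deriv ?_
    simp; ring_nf; simp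
  refine MonotoneOn.convexOn_of_deriv (convex_Icc 0 1) ?_ ?_ ?_
  · have : Continuous (fun t : ℝ => t ^ q) := Real.continuous_rpow_const h0.le
    refine Continuous.continuousOn ?_
    exact (this.comp (by fun_prop : Continuous fun y : ℝ => 1 + y)).sub
      (this.comp (by fun_prop : Continuous fun y : ℝ => 1 - y))
  · rw [interior_Icc]
    exact fun x hx => (hd x hx).differentiableAt.differentiableWithinAt
  · rw [interior_Icc]
    have : MonotoneOn (fun y : ℝ => q * ((1+y)^(q-1) + (1-y)^(q-1))) (Set.Ioo 0 1) := by
      apply monotoneOn_of_deriv_nonneg (convex_Ioo 0 1)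
      · exact fun x hx => (hd2 x hx).continuousAt.continuousWithinAt
      · rw [interior_Ioo]
        exact fun x hx => (hd2 x hx).differentiableAt.differentiableWithinAt
      · rw [interior_Ioo]
        intro x hx
        rw [(hd2 x hx).deriv]
        have : (1+x)^(q-2) ≤ (1-x)^(q-2) :=
          Real.rpow_le_rpow_of_nonpos (by linarith [hx.2]) (by linarith [hx.1]) (by linarith)
        have : 0 ≤ (1-x)^(q-2) - (1+x)^(q-2) := by linarith
        have : 0 ≤ 1 - q := by linarith
        positivity
    exact this.congr fun x hx => ((hd x hx).deriv).symm

lemma kh_b1 {q y : ℝ} (h0 : 0 < q) (h1 : q ≤ 1) (hy0 : 0 ≤ y) (hy1 : y ≤ 1) :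
    1/2 * ((1+y)^(1+q) + (1-y)^(1+q)) ≤ 1 + (2^q - 1) * y^2 := by
  set D : ℝ → ℝ := fun y => 1 + (2^q - 1) * y^2 - 1/2 * ((1+y)^(1+q) + (1-y)^(1+q)) with hD
  set D' : ℝ → ℝ := fun y => 2 * (2^q - 1) * y - (1+q)/2 * ((1+y)^q - (1-y)^q) with hD'
  have hcont : Continuous D := by
    have : Continuous (fun t : ℝ => t ^ (1+q)) := Real.continuous_rpow_const (by linarith)
    have a := this.comp (by fun_prop : Continuous fun y : ℝ => 1 + y)
    have b := this.comp (by fun_prop : Continuous fun y : ℝ => 1 - y)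
    have c : Continuous (fun y : ℝ => 1 + (2^q - 1) * y^2) := by fun_prop
    exact c.sub ((a.add b).const_mul (1/2))
  have hd : ∀ x, HasDerivAt D (D' x) x := by
    intro x
    have a := ((hasDerivAt_id x).const_add 1).rpow_const (p := 1+q) (Or.inr (by linarith))
    have b := ((hasDerivAt_id x).const_sub 1).rpow_const (p := 1+q) (Or.inr (by linarith))
    have c := (((hasDerivAt_id x).pow 2).const_mul ((2:ℝ)^q - 1)).const_add 1
    refine (c.sub ((a.add b).const_mul (1/2))).congr_deriv ?_
    simp [hD']; ring
  have D0 : D 0 = 0 := by simp [hD]; norm_num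
  have D1 : D 1 = 0 := by
    simp only [hD]
    norm_num
    rw [Real.zero_rpow (by linarith), Real.rpow_add (by norm_num)]
    simp
  suffices 0 ≤ D y by simp only [hD] at this; linarith
  by_contra hneg
  push Not at hneg
  have hy0' : 0 < y := by
    rcases eq_or_lt_of_le hy0 with h | h
    · rw [← h, D0] at hneg; exact absurd hneg (lt_irrefl _)
    · exact h
  have hy1' : y < 1 := by
    rcases eq_or_lt_of_le hy1 with h | h
    · rw [h, D1] at hneg; exact absurd hneg (lt_irrefl _)
    · exact h
  obtain ⟨a, ha, hae⟩ := exists_hasDerivAt_eq_slope D D' hy0' hcont.continuousOn (fun x _ => hd x)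
  obtain ⟨b, hb, hbe⟩ := exists_hasDerivAt_eq_slope D D' hy1' hcont.continuousOn (fun x _ => hd x)
  rw [D0] at hae
  rw [D1] at hbe
  have ha' : D' a < 0 := by rw [hae]; apply div_neg_of_neg_of_pos <;> linarith
  have hb' : 0 < D' b := by rw [hbe]; apply div_pos <;> linarith
  have hb0 : 0 < b := by linarith [hb.1]
  have hab : a < b := by linarith [ha.2, hb.1]
  have hc := (kh_phi_convex h0 h1).2 (show (0:ℝ) ∈ Set.Icc (0:ℝ) 1 by simp)
    (show b ∈ Set.Icc (0:ℝ) 1 from ⟨hb0.le, hb.2.le⟩)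
    (show 0 ≤ 1 - a/b by rw [sub_nonneg, div_le_one hb0]; exact hab.le)
    (show 0 ≤ a/b by have := ha.1; positivity) (by ring)
  simp only [smul_eq_mul, mul_zero, zero_add, add_zero, sub_zero, Real.one_rpow, sub_self,
    div_mul_cancel₀ a hb0.ne'] at hc
  have : a / b * D' b ≤ D' a := by
    simp only [hD']
    have e : a / b * (2 * (2 ^ q - 1) * b) = 2 * (2^q-1) * a := by field_simp
    have := mul_le_mul_of_nonneg_left hc (show 0 ≤ (1+q)/2 by positivity)
    nlinarith
  have : 0 < a / b * D' b := by have := ha.1; positivity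
  linarith

lemma kh_b2 {q δ : ℝ} (h0 : 0 < q) (h1 : q ≤ 1) (hδ : 0 < δ) :
    1/2 * ((2+δ)^(1+q) - δ^(1+q)) ≤ 1 + kh_c1 q * (1+δ)^2 := by
  have hc := kh_c1_ge h0 h1
  have h2 := kh_two_le h0.le h1
  have a1 : δ^(1+q) ≥ δ - q * (0.1 + 1.3026 * δ) := by
    rw [Real.rpow_add hδ, Real.rpow_one, Real.rpow_def_of_pos hδ]
    have e1 := Real.add_one_le_exp (Real.log δ * q)
    have e2 : -Real.log δ ≤ 1/(10*δ) + 1.3026 := by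
      have := Real.log_le_sub_one_of_pos (show 0 < 1/(10*δ) by positivity)
      rw [Real.log_div (by norm_num) (by positivity), Real.log_mul (by norm_num) hδ.ne', Real.log_one] at this
      have := kh_log10
      norm_num at *; linarith
    have e3 : -(δ * Real.log δ) ≤ 0.1 + 1.3026 * δ := by
      have := mul_le_mul_of_nonneg_left e2 hδ.le
      have e : δ * (1/(10*δ) + 1.3026) = 0.1 + 1.3026 * δ := by field_simp; ring
      rw [e] at this; linarith
    have e4 := mul_le_mul_of_nonneg_left e3 h0.le
    have e5 := mul_le_mul_of_nonneg_left e1 hδ.le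
    linarith
  have a2 : (2+δ)^(1+q) ≤ (2+δ) * ((1 + 0.6932 * q + 0.3069 * q ^ 2) * (1 + q * (δ/2))) := by
    rw [Real.rpow_add (by positivity), Real.rpow_one]
    gcongr
    rw [show 2 + δ = 2 * (1 + δ/2) by ring, Real.mul_rpow (by norm_num) (by positivity)]
    gcongr
    exact rpow_one_add_le_one_add_mul_self (by linarith) h0.le h1
  have hsq : 0 ≤ (1+δ)^2 := by positivity
  have a3 := mul_le_mul_of_nonneg_right hc hsq
  have p1 : 0 ≤ q * δ := by positivity
  have p2 : 0 ≤ q * δ^2 := by positivity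
  have p3 : 0 ≤ q^2 * δ := by positivity
  have p4 : 0 ≤ q^2 * δ^2 := by positivity
  have p5 : q^3 * δ ≤ q^2 * δ := by
    apply mul_le_mul_of_nonneg_right _ hδ.le
    exact pow_le_pow_of_le_one h0.le h1 (by norm_num)
  have p6 : q^3 * δ^2 ≤ q^2 * δ^2 := by
    apply mul_le_mul_of_nonneg_right _ (by positivity)
    exact pow_le_pow_of_le_one h0.le h1 (by norm_num)
  have p7 : 0 ≤ q^2 := by positivity
  have p8 : q^2 * δ^2 ≤ q * δ^2 := by
    apply mul_le_mul_of_nonneg_right _ (by positivity)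
    nlinarith
  norm_num at *
  nlinarith

/-- the odd power function -/
noncomputable def kh_psi (q z : ℝ) : ℝ := z * |z| ^ q

lemma kh_b {q : ℝ} (h0 : 0 < q) (h1 : q ≤ 1) (Y : ℝ) :
    1/2 * (kh_psi q (1+Y) + kh_psi q (1-Y)) ≤ 1 + kh_c1 q * Y^2 := by
  wlog hY : 0 ≤ Y generalizing Y
  · have := this (-Y) (by linarith)
    simp only [neg_sq, sub_neg_eq_add] at this
    rw [add_comm (kh_psi q (1+Y))]
    exact this
  unfold kh_psi
  rw [abs_of_nonneg (show 0 ≤ 1 + Y by linarith)]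
  have e1 : (1+Y) * (1+Y)^q = (1+Y)^(1+q) := by
    rw [Real.rpow_add (by linarith), Real.rpow_one]
  rw [e1]
  rcases le_or_gt Y 1 with h | h
  · rw [abs_of_nonneg (show 0 ≤ 1 - Y by linarith)]
    have e2 : (1-Y) * (1-Y)^q = (1-Y)^(1+q) := by
      rcases eq_or_lt_of_le h with h | h
      · rw [h]; simp; rw [Real.zero_rpow (by linarith)]
      · rw [Real.rpow_add (by linarith), Real.rpow_one]
    rw [e2]
    refine (kh_b1 h0 h1 hY h).trans ?_
    have := kh_c1_ge h0 h1
    have := kh_two_le h0.le h1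
    gcongr
    norm_num at *
    nlinarith
  · rw [abs_of_neg (show 1 - Y < 0 by linarith)]
    have := kh_b2 h0 h1 (show 0 < Y - 1 by linarith)
    rw [Real.rpow_add (show 0 < Y - 1 by linarith), Real.rpow_one] at this
    rw [show 2 + (Y - 1) = 1 + Y by ring, show 1 + (Y - 1) = Y by ring] at this
    rw [show -(1 - Y) = Y - 1 by ring]
    linarith

/-- final comparison in the large coefficient case -/
lemma kh_chord {q x : ℝ} (h0 : 0 < q) (h1 : q ≤ 1) (hx0 : 0 ≤ x) (hx1 : x ≤ 0.85) :
    1 + kh_c1 q * x ≤ kh_B (q+2) * (1+x)^(q/2) := by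
  have hB : 1 ≤ kh_B (q+2) := by
    rw [kh_B_eq]
    have a := kh_g_low h0 h1
    have b : (1:ℝ) ≤ 2 ^ (q/2) := Real.one_le_rpow (by norm_num) (by positivity)
    have : 1 ≤ kh_g q := by nlinarith [sq_nonneg q]
    nlinarith
  have hc := (Real.concaveOn_rpow (p := q/2) (by positivity) (by linarith)).2
    (show (1:ℝ) ∈ Set.Ici (0:ℝ) by simp) (show (1.85:ℝ) ∈ Set.Ici (0:ℝ) by norm_num)
    (show 0 ≤ 1 - x/0.85 by rw [sub_nonneg, div_le_one (by norm_num)]; exact hx1)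
    (show 0 ≤ x/0.85 by positivity) (by ring)
  simp only [smul_eq_mul, Real.one_rpow] at hc
  rw [show (1 - x/0.85) * 1 + x/0.85 * 1.85 = 1 + x by ring] at hc
  have h2 := mul_le_mul_of_nonneg_left hc (show 0 ≤ kh_B (q+2) by linarith)
  refine le_trans ?_ h2
  have e : kh_B (q+2) * (1.85:ℝ)^(q/2) = (3.7:ℝ)^(q/2) * kh_g q := by
    rw [kh_B_eq, show (3.7:ℝ) = 2 * 1.85 by norm_num, Real.mul_rpow (by norm_num) (by norm_num)]
    ring
  have e2 : kh_B (q+2) * ((1 - x/0.85) * 1 + x/0.85 * (1.85:ℝ)^(q/2)) =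
      kh_B (q+2) * (1 - x/0.85) + x/0.85 * ((3.7:ℝ)^(q/2) * kh_g q) := by rw [← e]; ring
  rw [e2]
  have : 0 ≤ 1 - x/0.85 := by rw [sub_nonneg, div_le_one (by norm_num)]; exact hx1
  have e3 : kh_c1 q * x = x/0.85 * ((3.7:ℝ)^(q/2) * kh_g q) - x/0.85 := by unfold kh_c1; ring
  rw [e3]
  nlinarith

end

section
open MeasureTheory Set

lemma kh_trig_rep {p s c0 c1 c2 c3 : ℝ} (h2 : 2 < p) (h4 : p < 4) (hs : 0 < s)
    (e0 : c0 + c1 + c2 + c3 = 1) (e1 : 4 * c1 + 16 * c2 + 36 * c3 = s)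
    (hle : c1 * 2 ^ p + c2 * 4 ^ p + c3 * 6 ^ p ≤ s ^ (p/2) * kh_B p) :
    IntegrableOn (fun x => (Real.exp (-s * x ^ 2 / 2) - (c0 + c1 * Real.cos (2*x) + c2 * Real.cos (4*x)
      + c3 * Real.cos (6*x))) * x ^ (-p-1)) (Ioi 0) ∧
    0 ≤ ∫ x in Ioi (0:ℝ), (Real.exp (-s * x ^ 2 / 2) - (c0 + c1 * Real.cos (2*x) + c2 * Real.cos (4*x)
      + c3 * Real.cos (6*x))) * x ^ (-p-1) := by
  obtain ⟨hG, hGi⟩ := kh_gauss_rep h2 h4 hs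
  have i2 := (kh_scale_int h2 h4 2).const_mul c1
  have i4 := (kh_scale_int h2 h4 4).const_mul c2
  have i6 := (kh_scale_int h2 h4 6).const_mul c3
  have e : (fun x : ℝ => (Real.exp (-s * x ^ 2 / 2) - (c0 + c1 * Real.cos (2*x) + c2 * Real.cos (4*x)
      + c3 * Real.cos (6*x))) * x ^ (-p-1)) = fun x => (Real.exp (-s * x ^ 2 / 2) - 1 + s * x ^ 2 / 2) * x ^ (-p - 1)
      - c1 * (kh_W (2*x) * x ^ (-p-1)) - c2 * (kh_W (4*x) * x ^ (-p-1)) - c3 * (kh_W (6*x) * x ^ (-p-1)) := by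
    funext x
    unfold kh_W
    have : c0 = 1 - c1 - c2 - c3 := by linarith
    rw [this, ← e1]
    ring
  rw [e]
  have j1 : IntegrableOn (fun x : ℝ => (Real.exp (-s * x ^ 2 / 2) - 1 + s * x ^ 2 / 2) * x ^ (-p - 1)
      - c1 * (kh_W (2*x) * x ^ (-p-1))) (Ioi 0) := Integrable.sub hG i2
  have j2 : IntegrableOn (fun x : ℝ => (Real.exp (-s * x ^ 2 / 2) - 1 + s * x ^ 2 / 2) * x ^ (-p - 1)
      - c1 * (kh_W (2*x) * x ^ (-p-1)) - c2 * (kh_W (4*x) * x ^ (-p-1))) (Ioi 0) := Integrable.sub j1 i4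
  refine ⟨Integrable.sub j2 i6, ?_⟩
  rw [integral_sub j2 i6, integral_sub j1 i4, integral_sub hG i2, hGi, integral_const_mul,
    integral_const_mul, integral_const_mul, kh_scale h2, kh_scale h2, kh_scale h2]
  have hK := kh_K_pos h2 h4
  norm_num
  nlinarith

lemma kh_pow_eq (q : ℝ) : (2:ℝ)^(q+2) = 4 * 2^q ∧ (4:ℝ)^(q+2) = 16 * (2^q * 2^q) ∧
    (6:ℝ)^(q+2) = 36 * (2^q * 3^q) := by
  refine ⟨?_, ?_, ?_⟩
  · rw [Real.rpow_add (by norm_num)]; norm_num; ring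
  · rw [Real.rpow_add (by norm_num), show (4:ℝ)^q = 2^q*2^q by rw [← Real.mul_rpow] <;> norm_num]; norm_num; ring
  · rw [Real.rpow_add (by norm_num), show (6:ℝ)^q = 2^q*3^q by rw [← Real.mul_rpow] <;> norm_num]; norm_num; ring

lemma kh_spow {q σ : ℝ} (hσ : 0 < σ) : (2*σ)^((q+2)/2) * kh_B (q+2) = 2 * σ * 2^q * (σ^(q/2) * kh_g q) := by
  rw [kh_B_eq, show (q+2)/2 = q/2 + 1 by ring, Real.rpow_add (by positivity), Real.rpow_one,
    Real.mul_rpow (by norm_num) hσ.le]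
  have : (2:ℝ)^q = 2^(q/2) * 2^(q/2) := by rw [← Real.rpow_add (by norm_num)]; ring_nf
  rw [this]; ring

lemma kh_abs_cos_rpow (x σ : ℝ) : |Real.cos x| ^ (2*σ) = (Real.cos x ^ 2) ^ σ := by
  rw [Real.rpow_mul (abs_nonneg _)]
  norm_num

lemma kh_cos46 (x : ℝ) : Real.cos (2*x) = 2 * Real.cos x ^ 2 - 1 ∧
    Real.cos (4*x) = 2 * (2 * Real.cos x ^ 2 - 1)^2 - 1 ∧
    Real.cos (6*x) = 4 * (2 * Real.cos x ^ 2 - 1)^3 - 3 * (2 * Real.cos x ^ 2 - 1) := by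
  have h := Real.cos_two_mul x
  refine ⟨h, ?_, ?_⟩
  · rw [show 4*x = 2*(2*x) by ring, Real.cos_two_mul, h]
  · rw [show 6*x = 3*(2*x) by ring, Real.cos_three_mul, h]

lemma kh_L_I {q s : ℝ} (h0 : 0 < q) (h1 : q ≤ 1) (hs1 : 1.85 ≤ s) (hs2 : s ≤ 2) :
    ∃ L : ℝ → ℝ, IntegrableOn L (Ioi 0) ∧ 0 ≤ ∫ x in Ioi (0:ℝ), L x ∧
      ∀ x, 0 < x → L x ≤ (Real.exp (-s * x^2/2) - |Real.cos x| ^ s) * x ^ (-(q+2)-1) := by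
  obtain ⟨σ, rfl⟩ : ∃ σ, s = 2 * σ := ⟨s/2, by ring⟩
  have hσ0 : 0.925 ≤ σ := by norm_num at *; linarith
  have hσ1 : σ ≤ 1 := by linarith
  have hσp : 0 < σ := by norm_num at *; linarith
  obtain ⟨ha, hb⟩ := kh_trig_rep (p := q+2) (s := 2*σ) (c0 := 1-σ/2-3*σ*(1-σ)/16)
    (c1 := σ/2 + σ*(1-σ)/4) (c2 := -σ*(1-σ)/16) (c3 := 0) (by linarith) (by linarith) (by linarith)
    (by ring) (by ring) (by
      obtain ⟨t2, t4, t6⟩ := kh_pow_eq q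
      rw [t2, t4, t6, kh_spow hσp]
      have := kh_I (δ := 1 - σ) h0 h1 (by linarith) (by norm_num at *; linarith)
      rw [sub_sub_cancel] at this
      have := mul_le_mul_of_nonneg_left this (show 0 ≤ 2*σ*2^q by positivity)
      linarith)
  refine ⟨_, ha, hb, fun x hx => ?_⟩
  apply mul_le_mul_of_nonneg_right _ (by positivity)
  apply sub_le_sub_left
  rw [kh_abs_cos_rpow]
  refine (kh_rpow_le (sq_nonneg _) (Real.cos_sq_le_one x) hσp.le hσ1).trans (le_of_eq ?_)
  obtain ⟨u2, u4, u6⟩ := kh_cos46 x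
  rw [u2, u4, u6]
  ring

lemma kh_L_II {q s : ℝ} (h0 : 0 < q) (h1 : q ≤ 1) (hs1 : 2 ≤ s) (hs2 : s ≤ 4) :
    ∃ L : ℝ → ℝ, IntegrableOn L (Ioi 0) ∧ 0 ≤ ∫ x in Ioi (0:ℝ), L x ∧
      ∀ x, 0 < x → L x ≤ (Real.exp (-s * x^2/2) - |Real.cos x| ^ s) * x ^ (-(q+2)-1) := by
  obtain ⟨τ, rfl⟩ : ∃ τ, s = 2 * (1 + τ) := ⟨s/2 - 1, by ring⟩
  have hτ0 : 0 ≤ τ := by linarith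
  have hτ1 : τ ≤ 1 := by linarith
  obtain ⟨ha, hb⟩ := kh_trig_rep (p := q+2) (s := 2*(1+τ)) (c0 := 1/2 - τ/8 - τ*(1-τ)/32)
    (c1 := 1/2 + τ*(1-τ)/64) (c2 := τ/8 + τ*(1-τ)/32) (c3 := -(τ*(1-τ))/64) (by linarith) (by linarith) (by linarith)
    (by ring) (by ring) (by
      obtain ⟨t2, t4, t6⟩ := kh_pow_eq q
      rw [t2, t4, t6, kh_spow (by linarith)]
      have := kh_II h0 h1 hτ0 hτ1
      have := mul_le_mul_of_nonneg_left this (show (0:ℝ) ≤ 2*2^q by positivity)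
      linarith)
  refine ⟨_, ha, hb, fun x hx => ?_⟩
  apply mul_le_mul_of_nonneg_right _ (by positivity)
  apply sub_le_sub_left
  rw [kh_abs_cos_rpow]
  have e : (Real.cos x ^ 2)^(1+τ) = Real.cos x ^ 2 * (Real.cos x ^ 2)^τ := by
    rw [Real.rpow_add' (sq_nonneg _) (by linarith), Real.rpow_one]
  rw [e]
  refine (mul_le_mul_of_nonneg_left (kh_rpow_le (sq_nonneg _) (Real.cos_sq_le_one x) hτ0 hτ1) (sq_nonneg _)).trans (le_of_eq ?_)
  obtain ⟨u2, u4, u6⟩ := kh_cos46 x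
  rw [u2, u4, u6]
  ring

lemma kh_sin_ge {x : ℝ} (h0 : 0 ≤ x) (h1 : x ≤ Real.pi/2) : (x + x^3/3) * Real.cos x ≤ Real.sin x := by
  have hM : MonotoneOn (fun x : ℝ => Real.sin x - (x + x^3/3) * Real.cos x) (Icc 0 (Real.pi/2)) := by
    have hd : ∀ x : ℝ, HasDerivAt (fun x : ℝ => Real.sin x - (x + x^3/3) * Real.cos x)
        (x * (Real.sin x - x * Real.cos x) + x^3/3 * Real.sin x) x := by
      intro x
      have a := (hasDerivAt_id x).add (((hasDerivAt_id x).pow 3).div_const 3)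
      refine ((Real.hasDerivAt_sin x).sub (a.mul (Real.hasDerivAt_cos x))).congr_deriv ?_
      simp; ring
    apply monotoneOn_of_deriv_nonneg (convex_Icc _ _)
    · exact fun x hx => (hd x).continuousAt.continuousWithinAt
    · exact fun x hx => (hd x).differentiableAt.differentiableWithinAt
    · rw [interior_Icc]
      intro x hx
      rw [(hd x).deriv]
      have hs : 0 ≤ Real.sin x := Real.sin_nonneg_of_nonneg_of_le_pi hx.1.le (by linarith [hx.2, Real.pi_pos])
      have hxc : x * Real.cos x ≤ Real.sin x := by
        have hc : 0 < Real.cos x := Real.cos_pos_of_mem_Ioo ⟨by linarith [hx.1, Real.pi_pos], hx.2⟩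
        have := Real.lt_tan hx.1 hx.2
        rw [Real.tan_eq_sin_div_cos, lt_div_iff₀ hc] at this
        exact this.le
      have := hx.1
      have : 0 ≤ Real.sin x - x * Real.cos x := by linarith
      positivity
  have hp := Real.pi_pos
  have := hM (show (0:ℝ) ∈ Icc 0 (Real.pi/2) from ⟨le_rfl, by positivity⟩) (show x ∈ Icc 0 (Real.pi/2) from ⟨h0, h1⟩) h0
  simp at this
  linarith

lemma kh_cos_le_exp {x : ℝ} (h0 : 0 ≤ x) (h1 : x ≤ Real.pi/2) :
    Real.cos x ≤ Real.exp (-(x^2/2 + x^4/12)) := by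
  have hM : AntitoneOn (fun x : ℝ => Real.cos x * Real.exp (x^2/2 + x^4/12)) (Icc 0 (Real.pi/2)) := by
    have hd : ∀ x : ℝ, HasDerivAt (fun x : ℝ => Real.cos x * Real.exp (x^2/2 + x^4/12))
        (((x + x^3/3) * Real.cos x - Real.sin x) * Real.exp (x^2/2 + x^4/12)) x := by
      intro x
      have a := (((hasDerivAt_id x).pow 2).div_const 2).add (((hasDerivAt_id x).pow 4).div_const 12)
      refine ((Real.hasDerivAt_cos x).mul a.exp).congr_deriv ?_
      simp; ring
    apply antitoneOn_of_deriv_nonpos (convex_Icc _ _)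
    · exact fun x hx => (hd x).continuousAt.continuousWithinAt
    · exact fun x hx => (hd x).differentiableAt.differentiableWithinAt
    · rw [interior_Icc]
      intro x hx
      rw [(hd x).deriv]
      have := kh_sin_ge hx.1.le hx.2.le
      exact mul_nonpos_of_nonpos_of_nonneg (by linarith) (Real.exp_pos _).le
  have hp := Real.pi_pos
  have := hM (show (0:ℝ) ∈ Icc 0 (Real.pi/2) from ⟨le_rfl, by positivity⟩) (show x ∈ Icc 0 (Real.pi/2) from ⟨h0, h1⟩) h0
  simp at this
  rw [Real.exp_neg, ← one_div, le_div_iff₀ (Real.exp_pos _)]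
  exact this

lemma kh_exp_neg_le {z : ℝ} (hz : 0 ≤ z) : z - z^2/2 ≤ 1 - Real.exp (-z) := by
  have hM : MonotoneOn (fun z : ℝ => 1 - Real.exp (-z) - z + z^2/2) (Ici 0) := by
    have hd : ∀ x : ℝ, HasDerivAt (fun z : ℝ => 1 - Real.exp (-z) - z + z^2/2) (Real.exp (-x) - 1 + x) x := by
      intro x
      have a := ((((hasDerivAt_id x).neg.exp).const_sub 1).sub (hasDerivAt_id x)).add (((hasDerivAt_id x).pow 2).div_const 2)
      refine a.congr_deriv ?_
      simp
    apply monotoneOn_of_deriv_nonneg (convex_Ici _)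
    · exact fun x hx => (hd x).continuousAt.continuousWithinAt
    · exact fun x hx => (hd x).differentiableAt.differentiableWithinAt
    · intro x hx
      rw [(hd x).deriv]
      linarith [Real.add_one_le_exp (-x)]
  have := hM (Set.mem_Ici.2 le_rfl) (Set.mem_Ici.2 hz) hz
  simp at this
  linarith

end

section
open MeasureTheory Set

noncomputable def kh_N (x : ℝ) : ℝ := Real.sin (2*x) / 4 + Real.sin (4*x) / 32
noncomputable def kh_P (x : ℝ) : ℝ := 15/128 + Real.cos (2*x) / 8 + Real.cos (4*x) / 128
/-- majorant of `cos⁴x / x³` -/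
noncomputable def kh_Gm (x : ℝ) : ℝ := Real.cos x ^ 4 * (x^3)⁻¹ + 12 * kh_P x * (x^5)⁻¹

lemma kh_P_nonneg (x : ℝ) : 0 ≤ kh_P x := by
  unfold kh_P
  obtain ⟨u2, u4, -⟩ := kh_cos46 x
  rw [u2, u4]
  have : 0 ≤ Real.cos x ^ 2 := sq_nonneg _
  nlinarith

lemma kh_Gm_int : IntegrableOn kh_Gm (Ioi (Real.pi/2)) ∧
    ∫ x in Ioi (Real.pi/2), kh_Gm x = 3/(4*Real.pi^2) := by
  have hp := Real.pi_pos
  set H : ℝ → ℝ := fun x => -(3/16) * (x^2)⁻¹ + kh_N x * (x^3)⁻¹ - 3 * kh_P x * (x^4)⁻¹ with hH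
  have hd : ∀ x ∈ Ioi (0:ℝ), HasDerivAt H (kh_Gm x) x := by
    intro x hx
    have hx0 : x ≠ 0 := ne_of_gt hx
    have n : HasDerivAt kh_N (Real.cos (2*x)/2 + Real.cos (4*x)/8) x := by
      have a := ((hasDerivAt_id x).const_mul 2).sin.div_const 4
      have b := ((hasDerivAt_id x).const_mul 4).sin.div_const 32
      refine (a.add b).congr_deriv ?_
      simp; ring
    have pp : HasDerivAt kh_P (-kh_N x) x := by
      have a := ((hasDerivAt_id x).const_mul 2).cos.div_const 8
      have b := ((hasDerivAt_id x).const_mul 4).cos.div_const 128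
      refine ((a.const_add (15/128)).add b).congr_deriv ?_
      simp [kh_N]; ring
    have i2 := ((hasDerivAt_id x).pow 2).inv (by simpa using hx0)
    have i3 := ((hasDerivAt_id x).pow 3).inv (by simpa using hx0)
    have i4 := ((hasDerivAt_id x).pow 4).inv (by simpa using hx0)
    refine (((i2.const_mul (-(3/16))).add (n.mul i3)).sub ((pp.const_mul 3).mul i4)).congr_deriv ?_
    simp only [kh_Gm, id, Pi.pow_apply, Pi.inv_apply]
    obtain ⟨u2, u4, -⟩ := kh_cos46 x
    rw [u2, u4]
    field_simp
    push_cast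
    ring
  have hcont : ContinuousWithinAt H (Ici (Real.pi/2)) (Real.pi/2) :=
    (hd (Real.pi/2) (by simp; positivity)).continuousAt.continuousWithinAt
  have hd2 : ∀ x ∈ Ioi (Real.pi/2), HasDerivAt H (kh_Gm x) x := fun x hx =>
    hd x (lt_trans (show (0:ℝ) < Real.pi/2 by positivity) hx)
  have hpos : ∀ x ∈ Ioi (Real.pi/2), 0 ≤ kh_Gm x := by
    intro x hx
    have hx0 : 0 < x := lt_trans (show (0:ℝ) < Real.pi/2 by positivity) hx
    have := kh_P_nonneg x
    unfold kh_Gm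
    positivity
  have hlim : Filter.Tendsto H Filter.atTop (nhds 0) := by
    have ti : ∀ n : ℕ, n ≠ 0 → Filter.Tendsto (fun x : ℝ => (x^n)⁻¹) Filter.atTop (nhds 0) :=
      fun n hn => (Filter.tendsto_pow_atTop hn).inv_tendsto_atTop
    have a := (ti 2 (by norm_num)).const_mul (-(3/16))
    have b : Filter.Tendsto (fun x => kh_N x * (x^3)⁻¹) Filter.atTop (nhds 0) := by
      refine bdd_le_mul_tendsto_zero' 1 (Filter.Eventually.of_forall fun x => ?_) (ti 3 (by norm_num))
      unfold kh_N
      rw [abs_le]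
      constructor <;> linarith [Real.neg_one_le_sin (2*x), Real.neg_one_le_sin (4*x), Real.sin_le_one (2*x), Real.sin_le_one (4*x)]
    have c : Filter.Tendsto (fun x => 3 * kh_P x * (x^4)⁻¹) Filter.atTop (nhds 0) := by
      refine bdd_le_mul_tendsto_zero' 1 (Filter.Eventually.of_forall fun x => ?_) (ti 4 (by norm_num))
      unfold kh_P
      rw [abs_le]
      constructor <;> linarith [Real.neg_one_le_cos (2*x), Real.neg_one_le_cos (4*x), Real.cos_le_one (2*x), Real.cos_le_one (4*x)]
    have := (a.add b).sub c
    simpa [hH] using this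
  refine ⟨integrableOn_Ioi_deriv_of_nonneg hcont hd2 hpos hlim, ?_⟩
  rw [integral_Ioi_of_hasDerivAt_of_nonneg hcont hd2 hpos hlim]
  have n0 : kh_N (Real.pi/2) = 0 := by
    unfold kh_N
    rw [show 2 * (Real.pi/2) = Real.pi by ring, show 4 * (Real.pi/2) = 2 * Real.pi by ring]
    simp
  have p0 : kh_P (Real.pi/2) = 0 := by
    unfold kh_P
    rw [show 2 * (Real.pi/2) = Real.pi by ring, show 4 * (Real.pi/2) = 2 * Real.pi by ring]
    simp
    norm_num
  simp only [hH, n0, p0]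
  field_simp
  ring

lemma kh_L1_int {s : ℝ} (hs : 0 < s) :
    IntegrableOn (fun x : ℝ => Real.exp (-s*x^2/2) * (s*x/12) * (1 - s*x^4/24)) (Ioi 0) ∧
    ∫ x in Ioi (0:ℝ), Real.exp (-s*x^2/2) * (s*x/12) * (1 - s*x^4/24) = 1/12 - 1/(36*s) := by
  have e : (fun x : ℝ => Real.exp (-s*x^2/2) * (s*x/12) * (1 - s*x^4/24)) =
      fun x => s/12 * (x^(1:ℝ) * Real.exp (-(s/2) * x^(2:ℝ))) - s^2/288 * (x^(5:ℝ) * Real.exp (-(s/2) * x^(2:ℝ))) := by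
    funext x
    norm_num
    ring_nf
  have i1 := (integrableOn_rpow_mul_exp_neg_mul_rpow (p := 2) (s := 1) (b := s/2) (by norm_num) (by norm_num) (by positivity)).const_mul (s/12)
  have i5 := (integrableOn_rpow_mul_exp_neg_mul_rpow (p := 2) (s := 5) (b := s/2) (by norm_num) (by norm_num) (by positivity)).const_mul (s^2/288)
  rw [e]
  refine ⟨Integrable.sub i1 i5, ?_⟩
  rw [integral_sub i1 i5, integral_const_mul, integral_const_mul,
    integral_rpow_mul_exp_neg_mul_rpow (by norm_num) (by norm_num) (by positivity),
    integral_rpow_mul_exp_neg_mul_rpow (by norm_num) (by norm_num) (by positivity)]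
  have g3 : Real.Gamma 3 = 2 := by
    rw [show (3:ℝ) = ((2:ℕ):ℝ)+1 by norm_num, Real.Gamma_nat_eq_factorial]
    norm_num [Nat.factorial]
  rw [show -((1:ℝ)+1)/2 = -1 by norm_num, show -((5:ℝ)+1)/2 = -3 by norm_num,
    show ((1:ℝ)+1)/2 = 1 by norm_num, show ((5:ℝ)+1)/2 = 3 by norm_num, Real.Gamma_one, g3,
    Real.rpow_neg (by positivity), Real.rpow_neg (by positivity), Real.rpow_one]
  rw [show (s/2)^(3:ℝ) = (s/2)^3 by norm_num]
  field_simp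
  ring

lemma kh_L_III {q s : ℝ} (h0 : 0 < q) (hs : 4 ≤ s) :
    ∃ L : ℝ → ℝ, IntegrableOn L (Ioi 0) ∧ 0 ≤ ∫ x in Ioi (0:ℝ), L x ∧
      ∀ x, 0 < x → L x ≤ (Real.exp (-s * x^2/2) - |Real.cos x| ^ s) * x ^ (-(q+2)-1) := by
  have hp := Real.pi_pos
  have hs0 : 0 < s := by linarith
  obtain ⟨hG, hGi⟩ := kh_Gm_int
  obtain ⟨h1, h1i⟩ := kh_L1_int hs0
  have hsub : Ioi (Real.pi/2) ⊆ Ioi (0:ℝ) := Ioi_subset_Ioi (by positivity)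
  have hGind : IntegrableOn ((Ioi (Real.pi/2)).indicator kh_Gm) (Ioi 0) := by
    rw [IntegrableOn, integrable_indicator_iff measurableSet_Ioi, IntegrableOn,
      Measure.restrict_restrict measurableSet_Ioi, inter_eq_left.2 hsub]
    exact hG
  have hGindi : ∫ x in Ioi (0:ℝ), (Ioi (Real.pi/2)).indicator kh_Gm x = 3/(4*Real.pi^2) := by
    rw [setIntegral_indicator measurableSet_Ioi, inter_eq_right.2 hsub, hGi]
  have hsubI : IntegrableOn (fun x => Real.exp (-s*x^2/2) * (s*x/12) * (1 - s*x^4/24)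
    - (Ioi (Real.pi/2)).indicator kh_Gm x) (Ioi 0) := Integrable.sub h1 hGind
  refine ⟨fun x => (Real.pi/2)^(-q) * (Real.exp (-s*x^2/2) * (s*x/12) * (1 - s*x^4/24)
    - (Ioi (Real.pi/2)).indicator kh_Gm x), hsubI.const_mul _, ?_, ?_⟩
  · rw [integral_const_mul, integral_sub h1 hGind, h1i, hGindi]
    apply mul_nonneg (by positivity)
    have a : 1/(36*s) ≤ 1/144 := by
      apply one_div_le_one_div_of_le <;> linarith
    have b : 3/(4*Real.pi^2) ≤ 11/144 := by
      rw [div_le_div_iff₀ (by positivity) (by norm_num)]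
      nlinarith [Real.pi_gt_d4]
    linarith
  · intro x hx
    have ex : x ^ (-(q+2)-1) = x^(-q) * (x^3)⁻¹ := by
      rw [show -(q+2)-1 = -q + -3 by ring, Real.rpow_add hx, Real.rpow_neg hx.le 3]
      norm_num
    rw [ex]
    beta_reduce
    rcases le_or_gt x (Real.pi/2) with h | h
    · rw [indicator_of_notMem (show x ∉ Ioi (Real.pi/2) from not_lt.2 h), sub_zero]
      have hc0 : 0 ≤ Real.cos x := Real.cos_nonneg_of_mem_Icc ⟨by linarith, h⟩
      set z := s*x^4/12 with hz
      have hz0 : 0 ≤ z := by positivity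
      have hcos : |Real.cos x|^s ≤ Real.exp (-s*x^2/2) * Real.exp (-z) := by
        rw [abs_of_nonneg hc0]
        refine (Real.rpow_le_rpow hc0 (kh_cos_le_exp hx.le h) hs0.le).trans (le_of_eq ?_)
        rw [← Real.exp_mul, ← Real.exp_add, hz]
        ring_nf
      have hz1 := kh_exp_neg_le hz0
      have hE := Real.exp_pos (-s*x^2/2)
      have hd : Real.exp (-s*x^2/2) * (z - z^2/2) ≤ Real.exp (-s*x^2/2) - |Real.cos x|^s := by
        have := mul_le_mul_of_nonneg_left hz1 hE.le
        linarith
      have hd0 : 0 ≤ Real.exp (-s*x^2/2) - |Real.cos x|^s := by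
        have : Real.exp (-z) ≤ 1 := Real.exp_le_one_iff.2 (by linarith)
        have := mul_le_mul_of_nonneg_left this hE.le
        linarith
      have e1 : (Real.pi/2)^(-q) * (Real.exp (-s*x^2/2) * (s*x/12) * (1 - s*x^4/24)) =
          (Real.pi/2)^(-q) * (x^3)⁻¹ * (Real.exp (-s*x^2/2) * (z - z^2/2)) := by
        rw [hz]; field_simp; ring
      rw [e1]
      have hpq : (Real.pi/2)^(-q) ≤ x^(-q) := Real.rpow_le_rpow_of_nonpos hx h (by linarith)
      calc (Real.pi/2)^(-q) * (x^3)⁻¹ * (Real.exp (-s*x^2/2) * (z - z^2/2)) 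
          ≤ (Real.pi/2)^(-q) * (x^3)⁻¹ * (Real.exp (-s*x^2/2) - |Real.cos x|^s) :=
            mul_le_mul_of_nonneg_left hd (by positivity)
        _ ≤ x^(-q) * (x^3)⁻¹ * (Real.exp (-s*x^2/2) - |Real.cos x|^s) := by
            apply mul_le_mul_of_nonneg_right _ hd0
            gcongr
        _ = _ := by ring
    · rw [indicator_of_mem (show x ∈ Ioi (Real.pi/2) from h)]
      have hx4 : 24 ≤ s * x^4 := by
        have a : 1.57 ≤ x := by have := Real.pi_gt_d2; norm_num at *; linarith
        have b : (1.57:ℝ)^4 ≤ x^4 := by gcongr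
        norm_num at b
        nlinarith
      have hE := Real.exp_pos (-s*x^2/2)
      have n1 : Real.exp (-s*x^2/2) * (s*x/12) * (1 - s*x^4/24) ≤ 0 :=
        mul_nonpos_of_nonneg_of_nonpos (by positivity) (by linarith)
      have n2 : Real.cos x ^ 4 * (x^3)⁻¹ ≤ kh_Gm x := by
        have := kh_P_nonneg x
        unfold kh_Gm
        have : 0 ≤ 12 * kh_P x * (x^5)⁻¹ := by positivity
        linarith
      have hpq : x^(-q) ≤ (Real.pi/2)^(-q) := Real.rpow_le_rpow_of_nonpos (by positivity) h.le (by linarith)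
      have hcos : |Real.cos x|^s ≤ Real.cos x ^ 4 := by
        have : |Real.cos x|^s ≤ |Real.cos x|^(4:ℝ) :=
          Real.rpow_le_rpow_of_exponent_ge_of_imp (abs_nonneg _) (Real.abs_cos_le_one x) hs (by intro _ h; linarith)
        refine this.trans (le_of_eq ?_)
        norm_num
        exact (show Even 4 by decide).pow_abs _
      calc _ ≤ (Real.pi/2)^(-q) * (-(Real.cos x ^ 4 * (x^3)⁻¹)) := by
            apply mul_le_mul_of_nonneg_left _ (by positivity)
            linarith
        _ ≤ x^(-q) * (-(Real.cos x ^ 4 * (x^3)⁻¹)) := by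
            apply mul_le_mul_of_nonpos_right hpq
            have : 0 ≤ Real.cos x ^ 4 * (x^3)⁻¹ := by positivity
            linarith
        _ = (-Real.cos x ^ 4) * (x^(-q) * (x^3)⁻¹) := by ring
        _ ≤ _ := by
            apply mul_le_mul_of_nonneg_right _ (by positivity)
            linarith

lemma kh_L {q s : ℝ} (h0 : 0 < q) (h1 : q ≤ 1) (hs1 : 1.85 ≤ s) :
    ∃ L : ℝ → ℝ, IntegrableOn L (Ioi 0) ∧ 0 ≤ ∫ x in Ioi (0:ℝ), L x ∧
      ∀ x, 0 < x → L x ≤ (Real.exp (-s * x^2/2) - |Real.cos x| ^ s) * x ^ (-(q+2)-1) := by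
  rcases le_total s 2 with h | h
  · exact kh_L_I h0 h1 hs1 h
  rcases le_total s 4 with h' | h'
  · exact kh_L_II h0 h1 h h'
  · exact kh_L_III h0 h'

end

section
open MeasureTheory Set

noncomputable def kh_ES {n : ℕ} (v : Fin n → ℝ) (φ : ℝ → ℝ) : ℝ :=
  (∑ a : Fin n → Bool, φ (∑ i, (if a i then (1:ℝ) else -1) * v i)) / 2 ^ n

lemma kh_ES_zero (v : Fin 0 → ℝ) (φ : ℝ → ℝ) : kh_ES v φ = φ 0 := by
  simp [kh_ES]

lemma kh_ES_succ {n : ℕ} (v : Fin (n+1) → ℝ) (φ : ℝ → ℝ) :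
    kh_ES v φ = (kh_ES (fun i => v i.succ) (fun x => φ (v 0 + x))
      + kh_ES (fun i => v i.succ) (fun x => φ (-v 0 + x))) / 2 := by
  unfold kh_ES
  rw [← (Fin.consEquiv (fun _ => Bool)).sum_comp, Fintype.sum_prod_type]
  simp only [Fin.consEquiv_apply, Fin.sum_univ_succ, Fin.cons_zero, Fin.cons_succ, Fintype.sum_bool,
    if_true, one_mul]
  simp only [Bool.false_eq_true, if_false, neg_one_mul]
  rw [pow_succ]
  ring

lemma kh_ES_mono {n : ℕ} (v : Fin n → ℝ) {φ ψ : ℝ → ℝ} (h : ∀ x, φ x ≤ ψ x) :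
    kh_ES v φ ≤ kh_ES v ψ := by
  unfold kh_ES
  gcongr
  exact h _

lemma kh_ES_add {n : ℕ} (v : Fin n → ℝ) (φ ψ : ℝ → ℝ) :
    kh_ES v (fun x => φ x + ψ x) = kh_ES v φ + kh_ES v ψ := by
  unfold kh_ES; rw [Finset.sum_add_distrib, add_div]

lemma kh_ES_sub {n : ℕ} (v : Fin n → ℝ) (φ ψ : ℝ → ℝ) :
    kh_ES v (fun x => φ x - ψ x) = kh_ES v φ - kh_ES v ψ := by
  unfold kh_ES; rw [Finset.sum_sub_distrib, sub_div]

lemma kh_ES_mul {n : ℕ} (v : Fin n → ℝ) (c : ℝ) (φ : ℝ → ℝ) :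
    kh_ES v (fun x => c * φ x) = c * kh_ES v φ := by
  unfold kh_ES; rw [← Finset.mul_sum, mul_div_assoc]

lemma kh_ES_const {n : ℕ} (v : Fin n → ℝ) (c : ℝ) : kh_ES v (fun _ => c) = c := by
  simp [kh_ES]

lemma kh_ES_smul {n : ℕ} (v : Fin n → ℝ) (c : ℝ) (φ : ℝ → ℝ) :
    kh_ES (fun i => c * v i) φ = kh_ES v (fun x => φ (c * x)) := by
  unfold kh_ES
  congr 1
  refine Finset.sum_congr rfl fun a _ => ?_
  beta_reduce
  rw [Finset.mul_sum]
  congr 1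
  exact Finset.sum_congr rfl fun i _ => by ring

lemma kh_ES_neg {n : ℕ} (v : Fin n → ℝ) (φ : ℝ → ℝ) :
    kh_ES v (fun x => φ (-x)) = kh_ES v φ := by
  unfold kh_ES
  congr 1
  rw [← (Equiv.piCongrRight (fun _ : Fin n => Equiv.boolNot)).sum_comp]
  refine Finset.sum_congr rfl fun a _ => ?_
  beta_reduce
  rw [← Finset.sum_neg_distrib]
  congr 1
  refine Finset.sum_congr rfl fun i _ => ?_
  cases h : a i <;> simp [h]

lemma kh_ES_perm {n : ℕ} (v : Fin n → ℝ) (σ : Equiv.Perm (Fin n)) (φ : ℝ → ℝ) :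
    kh_ES (fun i => v (σ i)) φ = kh_ES v φ := by
  unfold kh_ES
  congr 1
  rw [← (Equiv.arrowCongr σ.symm (Equiv.refl Bool)).sum_comp]
  refine Finset.sum_congr rfl fun a _ => ?_
  congr 1
  rw [← Equiv.sum_comp σ (fun i => (if a i then (1:ℝ) else -1) * v i)]
  refine Finset.sum_congr rfl fun i _ => ?_
  simp [Equiv.arrowCongr]

lemma kh_ES_sq_aux {n : ℕ} (v : Fin n → ℝ) : ∀ z : ℝ,
    kh_ES v (fun x => (z + x)^2) = z^2 + ∑ i, v i ^ 2 := by
  induction n with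
  | zero => intro z; simp [kh_ES_zero]
  | succ n ih =>
    intro z
    rw [kh_ES_succ]
    have e1 := ih (fun i => v i.succ) (z + v 0)
    have e2 := ih (fun i => v i.succ) (z + -v 0)
    simp only [add_assoc] at e1 e2
    rw [e1, e2, Fin.sum_univ_succ]
    ring

lemma kh_ES_sq {n : ℕ} (v : Fin n → ℝ) : kh_ES v (fun x => x^2) = ∑ i, v i ^ 2 := by
  simpa using kh_ES_sq_aux v 0

lemma kh_ES_cos_aux {n : ℕ} (v : Fin n → ℝ) (t : ℝ) : ∀ z : ℝ,
    kh_ES v (fun x => Real.cos (z + x * t)) = Real.cos z * ∏ i, Real.cos (v i * t) := by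
  induction n with
  | zero => intro z; simp [kh_ES_zero]
  | succ n ih =>
    intro z
    rw [kh_ES_succ]
    have e1 := ih (fun i => v i.succ) (z + v 0 * t)
    have e2 := ih (fun i => v i.succ) (z + -v 0 * t)
    simp only [add_assoc, ← add_mul] at e1 e2
    rw [e1, e2, Fin.prod_univ_succ, neg_mul, Real.cos_add, Real.cos_add, Real.cos_neg, Real.sin_neg]
    ring

lemma kh_ES_cos {n : ℕ} (v : Fin n → ℝ) (t : ℝ) :
    kh_ES v (fun x => Real.cos (x * t)) = ∏ i, Real.cos (v i * t) := by
  simpa using kh_ES_cos_aux v t 0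

lemma kh_ES_integral {n : ℕ} (v : Fin n → ℝ) (F : ℝ → ℝ → ℝ)
    (h : ∀ x, IntegrableOn (F x) (Ioi 0)) :
    IntegrableOn (fun t => kh_ES v (fun x => F x t)) (Ioi 0) ∧
    ∫ t in Ioi (0:ℝ), kh_ES v (fun x => F x t) = kh_ES v (fun x => ∫ t in Ioi (0:ℝ), F x t) := by
  unfold kh_ES
  constructor
  · exact (integrable_finsetSum _ fun a _ => h _).div_const _
  · rw [integral_div, integral_finsetSum _ fun a _ => h _]

lemma kh_M {q v : ℝ} (h0 : 0 < q) (h1 : q ≤ 1) (hv : v^2 ≤ 1/1.85) :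
    ∃ M : ℝ → ℝ, IntegrableOn M (Ioi 0) ∧ 0 ≤ ∫ x in Ioi (0:ℝ), M x ∧
      ∀ t, 0 < t → M t ≤
        v^2 * (Real.exp (-t^2/2) - |Real.cos (v*t)| ^ (1/v^2)) * t ^ (-(q+2)-1) := by
  rcases eq_or_ne v 0 with rfl | hv0
  · exact ⟨fun _ => 0, by simp, by simp, by simp⟩
  have hv2 : 0 < v^2 := by positivity
  have ha : 0 < |v| := abs_pos.2 hv0
  have hs : 1.85 ≤ 1/v^2 := by
    rw [le_div_iff₀ hv2]; norm_num at hv ⊢; linarith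
  obtain ⟨L, hL, hLi, hLx⟩ := kh_L h0 h1 hs
  refine ⟨fun t => v^2 * |v|^(q+2+1) * L (|v| * t), ?_, ?_, ?_⟩
  · refine Integrable.const_mul ?_ _
    have := (integrableOn_Ioi_comp_mul_left_iff L 0 ha).2 (by simpa using hL)
    exact this
  · rw [integral_const_mul, integral_comp_mul_left_Ioi L 0 ha]
    simp only [mul_zero, smul_eq_mul]
    positivity
  · intro t ht
    have h := hLx (|v| * t) (by positivity)
    have e1 : -(1/v^2) * (|v| * t)^2/2 = -t^2/2 := by
      rw [mul_pow, sq_abs]; field_simp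
    have e2 : |Real.cos (|v| * t)| = |Real.cos (v*t)| := by
      rcases abs_choice v with h | h <;> rw [h]
      rw [neg_mul, Real.cos_neg]
    rw [e1, e2, Real.mul_rpow ha.le ht.le] at h
    have := mul_le_mul_of_nonneg_left h (show 0 ≤ v^2 * |v|^(q+2+1) by positivity)
    refine this.trans (le_of_eq ?_)
    have e3 : |v|^(q+2+1) * |v| ^ (-(q+2)-1) = 1 := by
      rw [← Real.rpow_add ha]; simp
    linear_combination (v^2 * (Real.exp (-t^2/2) - |Real.cos (v*t)| ^ (1/v^2)) * t ^ (-(q+2)-1)) * e3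

lemma kh_amgm {n : ℕ} (v : Fin n → ℝ) (hv : ∑ i, v i ^ 2 = 1) (t : ℝ) :
    ∏ i, Real.cos (v i * t) ≤ ∑ i, v i ^ 2 * |Real.cos (v i * t)| ^ (1 / v i ^ 2) := by
  have := Real.geom_mean_le_arith_mean_weighted Finset.univ (fun i => v i ^ 2)
    (fun i => |Real.cos (v i * t)| ^ (1 / v i ^ 2)) (fun i _ => by positivity) hv
    (fun i _ => by positivity)
  refine le_trans ?_ this
  refine (le_abs_self _).trans (le_of_eq ?_)
  rw [Finset.abs_prod]
  refine Finset.prod_congr rfl fun i _ => ?_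
  rcases eq_or_ne (v i) 0 with h | h
  · simp [h]
  · rw [← Real.rpow_mul (abs_nonneg _), one_div, inv_mul_cancel₀ (by positivity), Real.rpow_one]

lemma kh_fourier {q : ℝ} (h0 : 0 < q) (h1 : q ≤ 1) {n : ℕ} (v : Fin n → ℝ)
    (hv : ∑ i, v i ^ 2 = 1) (hb : ∀ i, v i ^ 2 ≤ 1/1.85) :
    kh_ES v (fun x => |x| ^ (q+2)) ≤ kh_B (q+2) := by
  have h2 : 2 < q+2 := by linarith
  have h4 : q+2 < 4 := by linarith
  have hK := kh_K_pos h2 h4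
  obtain ⟨g1, g2⟩ := kh_gauss_rep h2 h4 (s := 1) one_pos
  obtain ⟨e1, e2⟩ := kh_ES_integral v (fun x t => kh_W (x*t) * t^(-(q+2)-1)) (kh_scale_int h2 h4)
  simp only [kh_scale h2] at e2
  have e3 : kh_ES v (fun x => |x|^(q+2) * kh_K (q+2)) = kh_K (q+2) * kh_ES v (fun x => |x|^(q+2)) := by
    rw [← kh_ES_mul]; simp only [mul_comm]
  rw [e3] at e2
  choose M hM1 hM2 hM3 using fun i => kh_M h0 h1 (hb i)
  have hMI : IntegrableOn (fun t => ∑ i, M i t) (Ioi 0) := integrable_finsetSum _ fun i _ => hM1 i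
  have hM0 : 0 ≤ ∫ t in Ioi (0:ℝ), ∑ i, M i t := by
    rw [integral_finsetSum _ fun i _ => hM1 i]
    exact Finset.sum_nonneg fun i _ => hM2 i
  have hle : ∫ t in Ioi (0:ℝ), ∑ i, M i t ≤ ∫ t in Ioi (0:ℝ),
      ((Real.exp (-1*t^2/2) - 1 + 1*t^2/2) * t^(-(q+2)-1)
        - kh_ES v (fun x => kh_W (x*t) * t^(-(q+2)-1))) := by
    refine setIntegral_mono_on hMI (Integrable.sub g1 e1) measurableSet_Ioi fun t ht => ?_
    have ht : 0 < t := ht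
    have w1 : kh_ES v (fun x => kh_W (x*t) * t^(-(q+2)-1)) =
        (∏ i, Real.cos (v i * t) - 1 + t^2/2) * t^(-(q+2)-1) := by
      have : (fun x => kh_W (x*t) * t^(-(q+2)-1)) =
          fun x => t^(-(q+2)-1) * ((Real.cos (x*t) - 1) + t^2/2 * x^2) := by
        funext x; unfold kh_W; ring
      rw [this, kh_ES_mul, kh_ES_add v (fun x => Real.cos (x*t) - 1) (fun x => t^2/2 * x^2),
        kh_ES_sub v (fun x => Real.cos (x*t)) (fun _ => 1), kh_ES_cos, kh_ES_const, kh_ES_mul, kh_ES_sq, hv]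
      ring
    rw [w1]
    calc ∑ i, M i t ≤ ∑ i, v i ^2 * (Real.exp (-t^2/2) - |Real.cos (v i*t)| ^ (1/v i^2)) * t ^ (-(q+2)-1) :=
          Finset.sum_le_sum fun i _ => hM3 i t ht
      _ = (Real.exp (-t^2/2) - ∑ i, v i ^ 2 * |Real.cos (v i * t)| ^ (1 / v i ^ 2)) * t ^ (-(q+2)-1) := by
          rw [← Finset.sum_mul]
          congr 1
          simp only [mul_sub]
          rw [Finset.sum_sub_distrib, ← Finset.sum_mul, hv, one_mul]
      _ ≤ (Real.exp (-t^2/2) - ∏ i, Real.cos (v i * t)) * t ^ (-(q+2)-1) := by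
          have := kh_amgm v hv t
          gcongr
      _ = _ := by
          rw [show -1*t^2/2 = -t^2/2 by ring]; ring
  rw [integral_sub g1 e1, g2, e2] at hle
  have : 0 ≤ kh_K (q+2) * (kh_B (q+2) - kh_ES v (fun x => |x|^(q+2))) := by
    rw [Real.one_rpow] at hle
    linarith
  have := nonneg_of_mul_nonneg_right this hK
  linarith

end

section
open MeasureTheory Set

lemma kh_ES_cons {n : ℕ} (v : Fin (n+1) → ℝ) (p : ℝ) :
    kh_ES v (fun x => |x|^p) = kh_ES (fun i => v i.succ) (fun x => |v 0 + x|^p) := by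
  rw [kh_ES_succ]
  have : kh_ES (fun i => v i.succ) (fun x => |-v 0 + x|^p)
      = kh_ES (fun i => v i.succ) (fun x => |v 0 + x|^p) := by
    rw [← kh_ES_neg]
    congr 1
    funext x
    rw [← abs_neg]; congr 2; ring
  rw [this]; ring

lemma kh_ES_norm {n : ℕ} (v : Fin n → ℝ) (c p : ℝ) :
    kh_ES (fun i => c * v i) (fun x => |x|^p) = |c|^p * kh_ES v (fun x => |x|^p) := by
  rw [kh_ES_smul, ← kh_ES_mul]
  congr 1
  funext x
  rw [abs_mul, Real.mul_rpow (abs_nonneg _) (abs_nonneg _)]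

lemma kh_fourier2 {q : ℝ} (h0 : 0 < q) (h1 : q ≤ 1) {n : ℕ} (v : Fin n → ℝ)
    (hv : 0 < ∑ i, v i ^ 2) (hb : ∀ i, v i ^ 2 ≤ (∑ i, v i ^ 2)/1.85) :
    kh_ES v (fun x => |x| ^ (q+2)) ≤ kh_B (q+2) * (∑ i, v i ^ 2) ^ ((q+2)/2) := by
  set σ := ∑ i, v i ^ 2 with hσ
  have hs : 0 < Real.sqrt σ := Real.sqrt_pos.2 hv
  have hs2 : Real.sqrt σ ^ 2 = σ := Real.sq_sqrt hv.le
  have e : v = fun i => Real.sqrt σ * (v i / Real.sqrt σ) := by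
    funext i; field_simp
  have hF := kh_fourier h0 h1 (fun i => v i / Real.sqrt σ) (by
      simp only [div_pow, hs2]
      rw [← Finset.sum_div, ← hσ, div_self hv.ne']) (by
      intro i
      simp only [div_pow, hs2]
      rw [div_le_iff₀ hv]
      have := hb i
      norm_num at this ⊢; linarith)
  rw [e, kh_ES_norm, abs_of_pos hs, mul_comm]
  have : Real.sqrt σ ^ (q+2) = σ ^ ((q+2)/2) := by
    rw [Real.sqrt_eq_rpow, ← Real.rpow_mul hv.le]; ring_nf
  rw [this]
  gcongr

lemma kh_psi_sym {q : ℝ} (h0 : 0 < q) (h1 : q ≤ 1) {n : ℕ} (w : Fin n → ℝ)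
    (hw : ∑ i, w i ^ 2 = 1) (y : ℝ) :
    kh_ES w (fun t => kh_psi q (1 + y*t)) ≤ 1 + kh_c1 q * y^2 := by
  have e : kh_ES w (fun t => kh_psi q (1 + y*t)) =
      kh_ES w (fun t => 1/2 * (kh_psi q (1 + y*t) + kh_psi q (1 - y*t))) := by
    rw [kh_ES_mul, kh_ES_add w (fun t => kh_psi q (1 + y*t)) (fun t => kh_psi q (1 - y*t))]
    have := kh_ES_neg w (fun t => kh_psi q (1 + y*t))
    simp only [mul_neg, ← sub_eq_add_neg] at this
    rw [this]; ring
  rw [e]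
  refine (kh_ES_mono w fun t => kh_b h0 h1 (y*t)).trans (le_of_eq ?_)
  have : (fun t => 1 + kh_c1 q * (y*t)^2) = fun t => 1 + (kh_c1 q * y^2) * t^2 := by
    funext t; ring
  rw [this, kh_ES_add w (fun _ => 1) (fun t => (kh_c1 q * y^2) * t^2), kh_ES_const, kh_ES_mul, kh_ES_sq, hw, mul_one]

lemma kh_f_deriv {q : ℝ} (h0 : 0 < q) {n : ℕ} (w : Fin n → ℝ) (y : ℝ) :
    HasDerivAt (fun y => kh_ES w (fun t => |1 + y*t|^(q+2)))
      ((q+2) * kh_ES w (fun t => t * kh_psi q (1+y*t))) y := by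
  have hd : ∀ t : ℝ, HasDerivAt (fun y => |1+y*t|^(q+2)) ((q+2) * (t * kh_psi q (1+y*t))) y := by
    intro t
    have a := hasDerivAt_abs_rpow (1+y*t) (p := q+2) (by linarith)
    have b : HasDerivAt (fun y => 1 + y*t) t y := by
      simpa using ((hasDerivAt_id y).mul_const t).const_add 1
    refine (a.comp y b).congr_deriv ?_
    rw [add_sub_cancel_right]; unfold kh_psi; ring
  rw [← kh_ES_mul]
  unfold kh_ES
  exact (HasDerivAt.fun_sum fun a _ => hd _).div_const _

lemma kh_large1 {q : ℝ} (h0 : 0 < q) (h1 : q ≤ 1) {n : ℕ} (w : Fin n → ℝ)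
    (hw : ∑ i, w i ^ 2 = 1) {y : ℝ} (hy0 : 0 ≤ y) (hy : y^2 ≤ 0.85) :
    kh_ES w (fun t => |1 + y*t|^(q+2)) ≤ kh_B (q+2) * (1+y^2)^((q+2)/2) := by
  set f : ℝ → ℝ := fun y => kh_ES w (fun t => |1 + y*t|^(q+2)) with hf
  set b := Real.sqrt 0.85 with hb
  have hb2 : b^2 = 0.85 := Real.sq_sqrt (by norm_num)
  have hb0 : 0 ≤ b := Real.sqrt_nonneg _
  have hpos : ∀ z : ℝ, 0 < 1 + z^2 := fun z => by positivity
  set R : ℝ → ℝ := fun y => f y * (1+y^2)^(-((q+2)/2)) with hR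
  have hRd : ∀ z, HasDerivAt R (((q+2) * kh_ES w (fun t => t * kh_psi q (1+z*t))) * (1+z^2)^(-((q+2)/2))
      + f z * ((2*z) * (-((q+2)/2)) * (1+z^2)^(-((q+2)/2)-1))) z := by
    intro z
    have a : HasDerivAt (fun z : ℝ => 1 + z^2) (2*z) z := by
      simpa using (hasDerivAt_pow 2 z).const_add 1
    exact (kh_f_deriv h0 w z).mul (a.rpow_const (Or.inl (hpos z).ne'))
  have hRc : Continuous R := continuous_iff_continuousAt.2 fun z => (hRd z).continuousAt
  have key : ∀ z, R z ≤ kh_B (q+2) ↔ f z ≤ kh_B (q+2) * (1+z^2)^((q+2)/2) := by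
    intro z
    simp only [hR]
    rw [Real.rpow_neg (hpos z).le, ← div_eq_mul_inv, div_le_iff₀ (Real.rpow_pos_of_pos (hpos z) _)]
  rw [show kh_ES w (fun t => |1 + y*t|^(q+2)) = f y from rfl, ← key]
  obtain ⟨z, hz, hmax⟩ := isCompact_Icc.exists_isMaxOn (nonempty_Icc.2 hb0) hRc.continuousOn
  have hyb : y ≤ b := Real.le_sqrt_of_sq_le hy
  refine (hmax (⟨hy0, hyb⟩ : y ∈ Icc 0 b)).trans ?_
  rw [key]
  rcases eq_or_lt_of_le hz.1 with hz0 | hz0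
  · rw [← hz0]
    have := kh_chord h0 h1 (x := 0) le_rfl (by norm_num)
    simpa [hf, kh_ES_const] using this
  rcases eq_or_lt_of_le hz.2 with hzb | hzb
  · have h := kh_fourier2 h0 h1 (Fin.cons 1 (fun i => b * w i) : Fin (n+1) → ℝ)
    rw [kh_ES_cons] at h
    simp only [Fin.sum_univ_succ, Fin.cons_zero, Fin.cons_succ, kh_ES_smul, mul_pow, ← Finset.mul_sum, hw] at h
    rw [hzb]
    simp only [one_pow, mul_one] at h
    refine h (hpos b) ?_
    intro i
    rw [hb2]
    refine Fin.cases ?_ (fun j => ?_) i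
    · norm_num
    · simp only [Fin.cons_succ, mul_pow, hb2]
      have : w j ^ 2 ≤ 1 := by
        rw [← hw]; exact Finset.single_le_sum (f := fun i => w i ^ 2) (fun i _ => sq_nonneg _) (Finset.mem_univ j)
      norm_num; linarith
  · have hloc : IsLocalMax R z := hmax.isLocalMax (Icc_mem_nhds hz0 hzb)
    have hd := hloc.hasDerivAt_eq_zero (hRd z)
    set A := kh_ES w (fun t => t * kh_psi q (1+z*t)) with hA
    set C := kh_ES w (fun t => kh_psi q (1+z*t)) with hC
    have hfz : f z = C + z * A := by
      rw [hA, hC, ← kh_ES_mul, ← kh_ES_add]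
      simp only [hf]
      congr 1
      funext t
      rw [Real.rpow_add_of_nonneg (abs_nonneg _) h0.le (by norm_num)]
      unfold kh_psi
      rw [Real.rpow_two, sq_abs]
      ring
    have hx := hpos z
    rw [Real.rpow_sub_one hx.ne'] at hd
    have hP : 0 < (1+z^2)^(-((q+2)/2)) := Real.rpow_pos_of_pos hx _
    have hd2 : (1+z^2) * A = z * f z := by
      have : ((q+2) * (1+z^2)^(-((q+2)/2))) * ((1+z^2) * A - z * f z) = 0 := by
        field_simp at hd
        linear_combination hd
      rcases mul_eq_zero.1 this with h | h
      · exfalso; have : 0 < (q+2) * (1+z^2)^(-((q+2)/2)) := by positivity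
        linarith
      · linarith
    have hfC : f z = (1+z^2) * C := by
      linear_combination (1+z^2)*hfz + z * hd2
    have hx85 : z^2 ≤ 0.85 := by rw [← hb2]; gcongr
    have hc := (kh_psi_sym h0 h1 w hw z).trans (kh_chord h0 h1 (sq_nonneg z) hx85)
    rw [hfC]
    calc (1+z^2) * C ≤ (1+z^2) * (kh_B (q+2) * (1+z^2)^(q/2)) := mul_le_mul_of_nonneg_left hc hx.le
      _ = _ := by
        rw [show (q+2)/2 = q/2 + 1 by ring, Real.rpow_add_one hx.ne']; ring

lemma kh_large {q : ℝ} (h0 : 0 < q) (h1 : q ≤ 1) {n : ℕ} (r : Fin n → ℝ)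
    (hr : ∑ i, r i ^ 2 ≤ 0.85) :
    kh_ES r (fun t => |1 + t|^(q+2)) ≤ kh_B (q+2) * (1+∑ i, r i ^ 2)^((q+2)/2) := by
  set σ := ∑ i, r i ^ 2 with hσ
  have hσ0 : 0 ≤ σ := Finset.sum_nonneg fun i _ => sq_nonneg _
  rcases eq_or_lt_of_le hσ0 with h | h
  · have hz : ∀ i, r i = 0 := by
      intro i
      have := (Finset.sum_eq_zero_iff_of_nonneg (fun i _ => sq_nonneg (r i))).1 (hσ.symm.trans h.symm) i (Finset.mem_univ i)
      simpa using this
    have e : kh_ES r (fun t => |1 + t|^(q+2)) = 1 := by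
      simp [kh_ES, hz]
    rw [e, ← h]
    have := kh_chord h0 h1 (x := 0) le_rfl (by norm_num)
    simpa using this
  · have hs : 0 < Real.sqrt σ := Real.sqrt_pos.2 h
    have hs2 : Real.sqrt σ ^ 2 = σ := Real.sq_sqrt h.le
    have e : r = fun i => Real.sqrt σ * (r i / Real.sqrt σ) := by
      funext i; field_simp
    have := kh_large1 h0 h1 (fun i => r i / Real.sqrt σ) (by
      simp only [div_pow, hs2]
      rw [← Finset.sum_div, ← hσ, div_self h.ne']) hs.le (by rw [hs2]; exact hr)
    rw [hs2, ← kh_ES_smul (fun i => r i / Real.sqrt σ) _ (fun t => |1+t|^(q+2)), ← e] at this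
    exact this

lemma kh_mid {q : ℝ} (h0 : 0 < q) (h1 : q ≤ 1) {n : ℕ} (v : Fin n → ℝ) (hv : 0 < ∑ i, v i ^ 2) :
    kh_ES v (fun x => |x| ^ (q+2)) ≤ kh_B (q+2) * (∑ i, v i ^ 2) ^ ((q+2)/2) := by
  by_cases hb : ∀ i, v i ^ 2 ≤ (∑ i, v i ^ 2)/1.85
  · exact kh_fourier2 h0 h1 v hv hb
  push Not at hb
  obtain ⟨k, hk⟩ := hb
  obtain ⟨m, rfl⟩ : ∃ m, n = m+1 := ⟨n-1, by have := k.pos; omega⟩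
  set σ := Equiv.swap 0 k
  rw [← kh_ES_perm v σ]
  have hσ : ∑ i, v i ^ 2 = ∑ i, v (σ i) ^ 2 := (Equiv.sum_comp σ (fun i => v i ^ 2)).symm
  have hk0 : v k = v (σ 0) := by simp [σ]
  rw [hσ] at hk hv ⊢
  rw [hk0] at hk
  set u : Fin (m+1) → ℝ := fun i => v (σ i) with hu
  change (∑ i, u i ^ 2)/1.85 < u 0 ^ 2 at hk
  change 0 < ∑ i, u i ^ 2 at hv
  change _ ≤ kh_B (q+2) * (∑ i, u i ^ 2) ^ ((q+2)/2)
  have hu0 : 0 < u 0 ^ 2 := lt_trans (by positivity) hk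
  have hne : u 0 ≠ 0 := by intro h; simp [h] at hu0
  rw [kh_ES_cons]
  set r : Fin m → ℝ := fun i => u i.succ / u 0 with hr
  have e1 : (fun i : Fin m => u i.succ) = fun i => u 0 * r i := by
    funext i; simp only [hr]; field_simp
  have e2 : ∑ i, u i ^ 2 = u 0 ^ 2 * (1 + ∑ i, r i ^ 2) := by
    rw [Fin.sum_univ_succ]
    simp only [hr, div_pow]
    rw [← Finset.sum_div]; field_simp
  have hr85 : ∑ i, r i ^ 2 ≤ 0.85 := by
    rw [e2, div_lt_iff₀ (by norm_num)] at hk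
    have := (mul_lt_mul_iff_right₀ hu0).1 hk
    norm_num at this ⊢; linarith
  have hr0 : 0 ≤ ∑ i, r i ^ 2 := Finset.sum_nonneg fun i _ => sq_nonneg _
  rw [e1, kh_ES_smul]
  have e3 : (fun x => |u 0 + u 0 * x|^(q+2)) = fun x => |u 0|^(q+2) * |1+x|^(q+2) := by
    funext x
    rw [← Real.mul_rpow (abs_nonneg _) (abs_nonneg _), ← abs_mul]; congr 2; ring
  rw [e3, kh_ES_mul, e2, Real.mul_rpow hu0.le (by positivity)]
  have e4 : (u 0 ^ 2)^((q+2)/2) = |u 0|^(q+2) := by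
    rw [← sq_abs, ← Real.rpow_two, ← Real.rpow_mul (abs_nonneg _)]; ring_nf
  rw [e4, mul_left_comm]
  exact mul_le_mul_of_nonneg_left (kh_large h0 h1 r hr85) (by positivity)

end

open MeasureTheory ProbabilityTheory Set

lemma kh_psi_deriv {q : ℝ} (hq : 1 < q) (u : ℝ) :
    HasDerivAt (kh_psi q) ((q+1) * |u|^q) u := by
  have a := (hasDerivAt_id u).mul (hasDerivAt_abs_rpow u hq)
  refine a.congr_deriv ?_
  simp only [id]
  rcases eq_or_ne u 0 with rfl | h
  · simp [Real.zero_rpow (show q ≠ 0 by linarith)]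
  · have : |u|^q = |u|^(q-2) * u^2 := by
      rw [← sq_abs, ← Real.rpow_two, ← Real.rpow_add (abs_pos.2 h)]; ring_nf
    rw [this]; ring

lemma kh_E_mono {q : ℝ} (hq : 1 < q) (z : ℝ) {x y : ℝ} (hx : 0 < x) (hxy : x ≤ y) :
    |z+x|^q + |z-x|^q ≤ |z+y|^q + |z-y|^q := by
  have hy : 0 < y := hx.trans_le hxy
  set θ := (1 + x/y)/2 with hθ
  have hd : x/y ≤ 1 := (div_le_one hy).2 hxy
  have hd0 : 0 < x/y := by positivity
  have h0 : 0 ≤ θ := by positivity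
  have h1 : 0 ≤ 1-θ := by rw [hθ]; linarith
  have key : ∀ a b α β : ℝ, 0 ≤ α → 0 ≤ β → α + β = 1 →
      |α*a+β*b|^q ≤ α * |a|^q + β * |b|^q := by
    intro a b α β hα hβ hs
    have h := (convexOn_rpow hq.le).2 (abs_nonneg a : |a| ∈ Ici 0) (abs_nonneg b : |b| ∈ Ici 0) hα hβ hs
    simp only [smul_eq_mul] at h
    refine le_trans ?_ h
    refine Real.rpow_le_rpow (abs_nonneg _) ?_ (by linarith)
    refine (abs_add_le _ _).trans ?_
    rw [abs_mul, abs_mul, abs_of_nonneg hα, abs_of_nonneg hβ]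
  have e1 : z+x = θ*(z+y) + (1-θ)*(z-y) := by rw [hθ]; field_simp; ring
  have e2 : z-x = (1-θ)*(z+y) + θ*(z-y) := by rw [hθ]; field_simp; ring
  have k1 := key (z+y) (z-y) θ (1-θ) h0 h1 (by ring)
  have k2 := key (z+y) (z-y) (1-θ) θ h1 h0 (by ring)
  rw [← e1] at k1
  rw [← e2] at k2
  linarith

lemma kh_k_convex {q : ℝ} (hq : 1 < q) (z : ℝ) :
    ConvexOn ℝ (Ici 0) (fun x => kh_psi q (z+x) - kh_psi q (z-x)) := by
  have hd : ∀ x, HasDerivAt (fun x => kh_psi q (z+x) - kh_psi q (z-x))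
      ((q+1) * (|z+x|^q + |z-x|^q)) x := by
    intro x
    have a := (kh_psi_deriv hq (z+x)).comp x ((hasDerivAt_id x).const_add z)
    have b := (kh_psi_deriv hq (z-x)).comp x ((hasDerivAt_id x).const_sub z)
    refine (a.sub b).congr_deriv ?_
    ring
  refine MonotoneOn.convexOn_of_deriv (convex_Ici 0)
    (fun x _ => (hd x).continuousAt.continuousWithinAt)
    (fun x _ => (hd x).differentiableAt.differentiableWithinAt) ?_
  rw [interior_Ici]
  intro x hx y _ hxy
  rw [(hd x).deriv, (hd y).deriv]
  exact mul_le_mul_of_nonneg_left (kh_E_mono hq z hx hxy) (by linarith)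

lemma kh_tangent {q : ℝ} (hq : 1 < q) (z : ℝ) {r : ℝ} (hr : 0 < r) :
    ∃ c : ℝ, ∀ x, |z+r|^(q+2) + |z-r|^(q+2) + c * (x^2 - r^2) ≤ |z+x|^(q+2) + |z-x|^(q+2) := by
  set k : ℝ → ℝ := fun x => kh_psi q (z+x) - kh_psi q (z-x) with hk
  have hkc : ConvexOn ℝ (Ici 0) k := kh_k_convex hq z
  have hk0 : k 0 = 0 := by simp [hk]
  -- k (θ y) ≤ θ k y
  have hks : ∀ x y, 0 < x → x ≤ y → k x * y ≤ k y * x := by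
    intro x y hx hxy
    have hy : 0 < y := hx.trans_le hxy
    have h := hkc.2 (show (0:ℝ) ∈ Ici (0:ℝ) from le_refl (0:ℝ)) (show y ∈ Ici (0:ℝ) from hy.le)
      (show 0 ≤ 1 - x/y by have := (div_le_one hy).2 hxy; linarith) (show 0 ≤ x/y by positivity) (by ring)
    simp only [smul_eq_mul, hk0, mul_zero, zero_add] at h
    rw [div_mul_cancel₀ _ hy.ne'] at h
    have := mul_le_mul_of_nonneg_right h hy.le
    refine this.trans (le_of_eq ?_)
    field_simp
  set G : ℝ → ℝ := fun x => |z+x|^(q+2) + |z-x|^(q+2) - (q+2) * k r / (2*r) * x^2 with hG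
  have hGd : ∀ x, HasDerivAt G ((q+2) * (k x - k r / r * x)) x := by
    intro x
    have a := (hasDerivAt_abs_rpow (z+x) (p := q+2) (by linarith)).comp x ((hasDerivAt_id x).const_add z)
    have b := (hasDerivAt_abs_rpow (z-x) (p := q+2) (by linarith)).comp x ((hasDerivAt_id x).const_sub z)
    refine ((a.add b).sub ((hasDerivAt_pow 2 x).const_mul ((q+2) * k r / (2*r)))).congr_deriv ?_
    simp only [hk, kh_psi, add_sub_cancel_right]
    field_simp
    push_cast
    ring
  have hGc : Continuous G := continuous_iff_continuousAt.2 fun x => (hGd x).continuousAt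
  have hpos : ∀ x, 0 ≤ x → G r ≤ G x := by
    intro x hx
    rcases le_total x r with h | h
    · have : AntitoneOn G (Icc 0 r) := by
        refine antitoneOn_of_deriv_nonpos (convex_Icc 0 r) hGc.continuousOn
          (fun x _ => (hGd x).differentiableAt.differentiableWithinAt) ?_
        rw [interior_Icc]
        intro y hy
        rw [(hGd y).deriv]
        refine mul_nonpos_of_nonneg_of_nonpos (by linarith) ?_
        have := hks y r hy.1 hy.2.le
        rw [sub_nonpos, div_mul_eq_mul_div, le_div_iff₀ hr]
        exact this
      exact this ⟨hx, h⟩ ⟨hr.le, le_rfl⟩ h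
    · have : MonotoneOn G (Ici r) := by
        refine monotoneOn_of_deriv_nonneg (convex_Ici r) hGc.continuousOn
          (fun x _ => (hGd x).differentiableAt.differentiableWithinAt) ?_
        rw [interior_Ici]
        intro y hy
        rw [(hGd y).deriv]
        refine mul_nonneg (by linarith) ?_
        have := hks r y hr (le_of_lt hy)
        rw [sub_nonneg, div_mul_eq_mul_div, div_le_iff₀ hr]
        exact this
      exact this (show r ∈ Ici r from le_refl r) h h
  have hev : ∀ x, G (-x) = G x := by
    intro x
    simp only [hG, sub_neg_eq_add, ← sub_eq_add_neg, neg_sq]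
    ring
  refine ⟨(q+2) * k r / (2*r), fun x => ?_⟩
  have h : G r ≤ G x := by
    rcases le_total 0 x with h | h
    · exact hpos x h
    · rw [← hev x]; exact hpos _ (by linarith)
  simp only [hG] at h
  linarith

lemma kh_gauss_int_neg {p : ℝ} (z : ℝ) (v : NNReal) :
    ∫ x, |z-x|^p ∂(gaussianReal 0 v) = ∫ x, |z+x|^p ∂(gaussianReal 0 v) := by
  have h := gaussianReal_map_neg (μ := 0) (v := v)
  rw [neg_zero] at h
  conv_rhs => rw [← h]
  rw [integral_map (by fun_prop)]
  · simp only [sub_eq_add_neg]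
  · refine Measurable.aestronglyMeasurable ?_
    fun_prop

lemma kh_gauss_step {q : ℝ} (hq : 1 < q) (z r : ℝ) :
    (|z+r|^(q+2) + |z-r|^(q+2))/2 ≤ ∫ x, |z+x|^(q+2) ∂(gaussianReal 0 (.mk (r^2) (sq_nonneg r))) := by
  wlog hr : 0 < r generalizing r
  · rcases eq_or_lt_of_le (not_lt.1 hr) with h | h
    · have : (NNReal.mk (r^2) (sq_nonneg r)) = 0 := by ext; simp [h]
      rw [this, gaussianReal_zero_var, integral_dirac, h]
      simp
    · have := this (-r) (by linarith)
      simp only [neg_sq, sub_neg_eq_add, ← sub_eq_add_neg] at this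
      linarith
  obtain ⟨c, hc⟩ := kh_tangent hq z hr
  set V : NNReal := .mk (r^2) (sq_nonneg r)
  have i1 := kh_gauss_abs_int (q+2) (by linarith) V z
  have i2 : Integrable (fun x => |z-x|^(q+2)) (gaussianReal 0 V) := by
    have h := gaussianReal_map_neg (μ := 0) (v := V)
    rw [neg_zero] at h
    have i := i1
    rw [← h, integrable_map_measure _ (by fun_prop)] at i
    · simpa [Function.comp_def, sub_eq_add_neg] using i
    · refine Measurable.aestronglyMeasurable ?_
      fun_prop
  have i3 : Integrable (fun x : ℝ => x^2) (gaussianReal 0 V) := by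
    simpa using kh_gauss_abs_int 2 (by norm_num) V 0
  have i4 : Integrable (fun x : ℝ => x^2 - r^2) (gaussianReal 0 V) := i3.sub (integrable_const _)
  have h := integral_mono ((integrable_const (|z+r|^(q+2) + |z-r|^(q+2))).add (i4.const_mul c)) (i1.add i2) hc
  simp only [Pi.add_apply] at h
  rw [integral_add (integrable_const _) (i4.const_mul c), integral_add i1 i2, integral_const_mul,
    integral_sub i3 (integrable_const _), kh_gauss_sq, kh_gauss_int_neg] at h
  simp [V] at h
  linarith

lemma kh_compare {q : ℝ} (hq : 1 < q) {n : ℕ} (v : Fin n → ℝ) : ∀ z : ℝ,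
    kh_ES v (fun x => |z+x|^(q+2)) ≤
      ∫ x, |z+x|^(q+2) ∂(gaussianReal 0 (∑ i, .mk (v i^2) (sq_nonneg _))) := by
  induction n with
  | zero => intro z; simp [kh_ES_zero]
  | succ n ih =>
    intro z
    set S : NNReal := ∑ i : Fin n, .mk (v i.succ^2) (sq_nonneg _) with hS
    set V : NNReal := .mk (v 0^2) (sq_nonneg _) with hV
    have hp : 0 < q+2 := by linarith
    have hconv : gaussianReal 0 (∑ i, .mk (v i^2) (sq_nonneg _)) = (gaussianReal 0 S) ∗ (gaussianReal 0 V) := by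
      rw [gaussianReal_conv_gaussianReal, Fin.sum_univ_succ, add_zero, add_comm S V]
    have hI := kh_gauss_abs_int (q+2) hp (∑ i, .mk (v i^2) (sq_nonneg _)) z
    rw [hconv] at hI ⊢
    have hm : AEStronglyMeasurable (fun x : ℝ => |z+x|^(q+2)) ((gaussianReal 0 S) ∗ (gaussianReal 0 V)) :=
      hI.1
    rw [integral_conv hI]
    rw [kh_ES_succ]
    have e1 := ih (fun i => v i.succ) (z + v 0)
    have e2 := ih (fun i => v i.succ) (z + -v 0)
    simp only [add_assoc] at e1 e2
    have j1 := kh_gauss_abs_int (q+2) hp S (z + v 0)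
    have j2 := kh_gauss_abs_int (q+2) hp S (z + -v 0)
    simp only [add_assoc] at j1 j2
    have hint : Integrable (fun x => ∫ y, |z + (x+y)|^(q+2) ∂(gaussianReal 0 V)) (gaussianReal 0 S) := by
      have h2 : Integrable (fun w : ℝ × ℝ => |z + (w.1+w.2)|^(q+2)) ((gaussianReal 0 S).prod (gaussianReal 0 V)) := by
        have := hI
        rw [Measure.conv, integrable_map_measure hm (by fun_prop)] at this
        exact this
      exact h2.integral_prod_left
    have hmono := integral_mono ((j1.add j2).div_const 2) hint (fun x => by
      have := kh_gauss_step hq (z+x) (v 0)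
      simp only [add_assoc] at this
      refine le_trans (le_of_eq ?_) this
      simp only [Pi.add_apply]
      congr 4 <;> ring)
    refine le_trans ?_ hmono
    simp only [Pi.add_apply]
    rw [integral_div, integral_add j1 j2]
    linarith

lemma kh_big {q : ℝ} (hq : 1 < q) {n : ℕ} (v : Fin n → ℝ) :
    kh_ES v (fun x => |x|^(q+2)) ≤ kh_B (q+2) * (∑ i, v i ^ 2)^((q+2)/2) := by
  have h := kh_compare hq v 0
  simp only [zero_add] at h
  refine h.trans (le_of_eq ?_)
  set S : NNReal := ∑ i : Fin n, .mk (v i^2) (sq_nonneg _) with hS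
  have hSr : (∑ i, v i ^ 2) = (S : ℝ) := by rw [hS]; push_cast; rfl
  have hmap := gaussianReal_map_const_mul (μ := 0) (v := 1) (Real.sqrt S)
  have hV : NNReal.mk (Real.sqrt S ^ 2) (sq_nonneg _) * 1 = S := by
    ext; simp
  rw [hV, mul_zero] at hmap
  rw [← hmap, integral_map (by fun_prop)]
  · simp only [abs_mul, Real.mul_rpow (abs_nonneg _) (abs_nonneg _)]
    rw [integral_const_mul, kh_gauss_moment _ (by linarith), hSr, abs_of_nonneg (Real.sqrt_nonneg _),
      Real.sqrt_eq_rpow, ← Real.rpow_mul S.coe_nonneg, mul_comm]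
    ring_nf
  · refine Measurable.aestronglyMeasurable ?_
    fun_prop

theorem khintchine (p : ℝ) (hp : 2 ≤ p) (n : ℕ) (v : Fin n → ℝ) :
    (∑ a : Fin n → Bool, |∑ i, (if a i then (1:ℝ) else -1) * v i| ^ p) / 2 ^ n ≤
      (2 ^ (p / 2) * Real.Gamma ((p + 1) / 2) / Real.sqrt Real.pi) *
        (∑ i, v i ^ 2) ^ (p / 2) := by
  change kh_ES v (fun x => |x|^p) ≤ kh_B p * (∑ i, v i ^ 2)^(p/2)
  rcases eq_or_lt_of_le hp with h | h
  · have hB : kh_B p = 1 := by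
      rw [← kh_gauss_moment p (by linarith), ← h]
      simpa using kh_gauss_sq 1
    rw [hB, ← h]
    simpa using (kh_ES_sq v).le
  obtain ⟨q, rfl⟩ : ∃ q, p = q+2 := ⟨p-2, by ring⟩
  rcases le_or_gt q 1 with h1 | h1
  · have hσ0 : 0 ≤ ∑ i, v i ^ 2 := Finset.sum_nonneg fun i _ => sq_nonneg _
    rcases eq_or_lt_of_le hσ0 with hz | hz
    · have hz0 : ∀ i, v i = 0 := by
        intro i
        have := (Finset.sum_eq_zero_iff_of_nonneg (fun i _ => sq_nonneg (v i))).1 hz.symm i (Finset.mem_univ i)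
        simpa using this
      have a : (q+2) ≠ 0 := by linarith
      have b : (q+2)/2 ≠ 0 := by positivity
      simp [kh_ES, hz0, Real.zero_rpow a, Real.zero_rpow b]
    · exact kh_mid (by linarith) h1 v hz
  · exact kh_big h1 v
end
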